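/- (Contraction estimate (4.15) for V₁.) Let N ≥ 2 and N ≤ p < 2N − 1. There exists C > 0, depending only on N, p and the Littlewood–Paley function, such that for all u₁, u₂ ∈ C_c^∞((0,∞)×ℝ^N; ℝ^N), defining for k = 1,2 the matrix fields P^{(k)}_{ij}(t,y) := Q_{ij}(∫₀^t Du_k(τ,y)dτ) and the nonlinear terms V₁(u_k) := ∑_{i,j,m=1}^N P^{(k)}_{im} ∂_i( P^{(k)}_{jm} ∂_j u_k ) + ∑_{i,j=1}^N P^{(k)}_{ij} ∂_i ∂_j u_k + ∑_{i,j=1}^N ∂_i( P^{(k)}_{ji} ∂_j u_k ), one has ‖V₁(u₁) − V₁(u₂)‖_{L¹(ℝ₊;Ḃ^{−1+N/p}_{p,1}(ℝ^N))} ≤ C ( max_{k=1,2} ∑_{r=1}^{2N−2} E(u_k)^r ) ‖D²(u₁ − u₂)‖_{L¹(ℝ₊;Ḃ^{−1+N/p}_{p,1}(ℝ^N))}. -/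

import Mathlib

open MeasureTheory
open scoped BigOperators ENNReal

noncomputable section

namespace MHD

/-- A Littlewood–Paley function on a finite-dimensional real inner product space:
a nonnegative, smooth, radial, radially nonincreasing function equal to `1` on the unit
ball and supported in the ball of radius `2`. -/
structure LPF (V : Type*) [NormedAddCommGroup V] [InnerProductSpace ℝ V]
    [FiniteDimensional ℝ V] [MeasurableSpace V] [BorelSpace V] where
  chi : V → ℝ
  smooth : ContDiff ℝ (⊤ : ℕ∞) chi
  nonneg : ∀ x, 0 ≤ chi x
  radial : ∀ x y : V, ‖x‖ = ‖y‖ → chi x = chi y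
  radial_antitone : ∀ x y : V, ‖x‖ ≤ ‖y‖ → chi y ≤ chi x
  eq_one : ∀ x : V, ‖x‖ ≤ 1 → chi x = 1
  supp : ∀ x : V, 2 ≤ ‖x‖ → chi x = 0

variable {V : Type*} [NormedAddCommGroup V] [InnerProductSpace ℝ V]
    [FiniteDimensional ℝ V] [MeasurableSpace V] [BorelSpace V]

/-- `φ̂(ξ) = χ̂(ξ/2) − χ̂(ξ)`. -/
def LPF.phiHat (χ : LPF V) (ξ : V) : ℝ := χ.chi ((2 : ℝ)⁻¹ • ξ) - χ.chi ξ

/-- The `k`-th homogeneous Littlewood–Paley block `Δ̇_k f = 𝓕⁻¹(φ̂(2^{-k}·)·𝓕f)`. -/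
def LPF.block (χ : LPF V) (k : ℤ) (f : V → ℂ) : V → ℂ :=
  FourierTransformInv.fourierInv
    (fun ξ : V => ((χ.phiHat ((2 : ℝ) ^ (-k) • ξ) : ℝ) : ℂ) * FourierTransform.fourier f ξ)

/-- The `k`-th Littlewood–Paley kernel `𝓕⁻¹(φ̂(2^{-k}·))`. -/
def LPF.kernel (χ : LPF V) (k : ℤ) : V → ℂ :=
  FourierTransformInv.fourierInv (fun ξ : V => ((χ.phiHat ((2 : ℝ) ^ (-k) • ξ) : ℝ) : ℂ))

/-- The homogeneous Besov norm `‖f‖_{Ḃ^s_{p,1}} = ∑_{k∈ℤ} 2^{sk} ‖Δ̇_k f‖_{L^p} ∈ [0,∞]`. -/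
def besov (χ : LPF V) (s p : ℝ) (f : V → ℂ) : ℝ≥0∞ :=
  ∑' k : ℤ, ENNReal.ofReal ((2 : ℝ) ^ (s * (k : ℝ))) *
    eLpNorm (χ.block k f) (ENNReal.ofReal p) volume

/-- The space-time norm `∫_I ‖u(t,·)‖_{Ḃ^s_{p,1}} dt ∈ [0,∞]`. -/
def besovT (χ : LPF V) (s p : ℝ) (I : Set ℝ) (u : ℝ → V → ℂ) : ℝ≥0∞ :=
  ∫⁻ t in I, besov χ s p (u t)

/-- Euclidean space `ℝ^n`. -/
abbrev Euc (n : ℕ) := EuclideanSpace ℝ (Fin n)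

/-- Partial derivative `∂_i f` in the `i`-th coordinate direction. -/
def pdv {n : ℕ} {F : Type*} [NormedAddCommGroup F] [NormedSpace ℝ F]
    (i : Fin n) (f : Euc n → F) (y : Euc n) : F :=
  fderiv ℝ f y (EuclideanSpace.single i 1)

/-- `u ∈ C_c^∞((0,∞) × ℝ^N ; F)`. -/
def SmoothCpt (N : ℕ) {F : Type*} [NormedAddCommGroup F] [NormedSpace ℝ F]
    (u : ℝ → Euc N → F) : Prop :=
  ContDiff ℝ (⊤ : ℕ∞) (Function.uncurry u) ∧ HasCompactSupport (Function.uncurry u) ∧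
    ∀ t : ℝ, t ≤ 0 → ∀ y, u t y = 0

/-- `Q` is the family of cofactor polynomials: `Q i j` has zero constant term and
`adjugate (1 + M) i j = δ_{ij} + (Q i j)(M)` for every real `N × N` matrix `M`. -/
def IsCofactorPoly (N : ℕ) (Q : Fin N → Fin N → MvPolynomial (Fin N × Fin N) ℝ) : Prop :=
  ∀ i j : Fin N,
    MvPolynomial.constantCoeff (Q i j) = 0 ∧
    ∀ M : Matrix (Fin N) (Fin N) ℝ,
      Matrix.adjugate (1 + M) i j =
        (if i = j then (1 : ℝ) else 0) +
          MvPolynomial.eval (fun v : Fin N × Fin N => M v.1 v.2) (Q i j)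

/-- The matrix field `P_{ij}(t,y) = Q_{ij}(∫₀ᵗ Du(τ,y) dτ)`. -/
def Pmat {N : ℕ} (Q : Fin N → Fin N → MvPolynomial (Fin N × Fin N) ℝ)
    (u : ℝ → Euc N → Euc N) (t : ℝ) (y : Euc N) (i j : Fin N) : ℝ :=
  MvPolynomial.eval
    (fun v : Fin N × Fin N => ∫ τ in (0 : ℝ)..t, pdv v.2 (fun z => u τ z v.1) y) (Q i j)

/-- `E(u) = ‖D²u‖_{L¹(ℝ₊; Ḃ^s_{p,1}(ℝ^N))}`, summed over all components and all pairs of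
spatial derivatives. -/
def EE {N : ℕ} (χ : LPF (Euc N)) (s p : ℝ) (u : ℝ → Euc N → Euc N) : ℝ≥0∞ :=
  ∑ m : Fin N, ∑ i : Fin N, ∑ j : Fin N,
    besovT χ s p (Set.Ioi 0) (fun t y => ((pdv i (pdv j fun z => u t z m) y : ℝ) : ℂ))

/-- `‖∂_t u‖_{L¹(ℝ₊; Ḃ^s_{p,1}(ℝ^N))}`, summed over components. -/
def dtNorm {N : ℕ} (χ : LPF (Euc N)) (s p : ℝ) (u : ℝ → Euc N → Euc N) : ℝ≥0∞ :=
  ∑ m : Fin N,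
    besovT χ s p (Set.Ioi 0) (fun t y => ((deriv (fun τ => u τ y m) t : ℝ) : ℂ))

end MHD

open MHD

noncomputable section


section

open Filter Topology FourierTransform SchwartzMap

section


/-! ### Integral inequalities -/

/-- Minkowski's integral inequality for nonnegative functions. -/
theorem lintegral_rpow_lintegral_le {α β : Type*} [MeasurableSpace α] [MeasurableSpace β]
    {μ : Measure α} {ν : Measure β} [SigmaFinite μ] [SigmaFinite ν] {q : ℝ} (hq : 1 ≤ q)
    {F : α → β → ℝ≥0∞} (hF : Measurable (Function.uncurry F)) :
    (∫⁻ x, (∫⁻ y, F x y ∂ν) ^ q ∂μ) ^ (1 / q) ≤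
      ∫⁻ y, (∫⁻ x, F x y ^ q ∂μ) ^ (1 / q) ∂ν := by
  have hq0 : 0 < q := by linarith
  set R := ∫⁻ y, (∫⁻ x, F x y ^ q ∂μ) ^ (1 / q) ∂ν with hR
  set G : α → ℝ≥0∞ := fun x => ∫⁻ y, F x y ∂ν with hG
  have hGm : Measurable G := hF.lintegral_prod_right'
  have key : ∀ H : α → ℝ≥0∞, Measurable H → (∀ x, H x ≤ G x) → ∫⁻ x, H x ^ q ∂μ ≠ ∞ →
      ∫⁻ x, H x ^ q ∂μ ≤ R ^ q := by
    intro H hHm hHG hfin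
    rcases eq_or_lt_of_le hq with rfl | hq1
    · simp only [ENNReal.rpow_one]
      refine (lintegral_mono hHG).trans ?_
      rw [hG, lintegral_lintegral_swap hF.aemeasurable, hR]
      simp
    set q' := q.conjExponent
    have hc : q'.HolderConjugate q := (Real.HolderConjugate.conjExponent hq1).symm
    have h1 : ∫⁻ x, H x ^ q ∂μ ≤ (∫⁻ x, H x ^ q ∂μ) ^ (1 / q') * R := by
      calc ∫⁻ x, H x ^ q ∂μ = ∫⁻ x, H x ^ (q - 1) * H x ∂μ := by
            refine lintegral_congr fun x => ?_
            conv_lhs => rw [show q = (q - 1) + 1 by ring]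
            rw [ENNReal.rpow_add_of_nonneg _ _ (by linarith) zero_le_one, ENNReal.rpow_one]
        _ ≤ ∫⁻ x, H x ^ (q - 1) * G x ∂μ := by gcongr with x; exact hHG x
        _ = ∫⁻ x, ∫⁻ y, H x ^ (q - 1) * F x y ∂ν ∂μ := by
            refine lintegral_congr fun x => ?_
            exact (lintegral_const_mul _ (hF.comp measurable_prodMk_left)).symm
        _ = ∫⁻ y, ∫⁻ x, H x ^ (q - 1) * F x y ∂μ ∂ν := by
            refine lintegral_lintegral_swap (Measurable.aemeasurable ?_)
            exact ((hHm.pow_const _).comp measurable_fst).mul hF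
        _ ≤ ∫⁻ y, (∫⁻ x, H x ^ q ∂μ) ^ (1 / q') * (∫⁻ x, F x y ^ q ∂μ) ^ (1 / q) ∂ν := by
            refine lintegral_mono fun y => ?_
            have := ENNReal.lintegral_mul_le_Lp_mul_Lq μ hc
              (f := fun x => H x ^ (q - 1)) (g := fun x => F x y)
              (hHm.pow_const _).aemeasurable (hF.comp measurable_prodMk_right).aemeasurable
            refine this.trans (le_of_eq ?_)
            congr 3
            ext x
            rw [← ENNReal.rpow_mul]
            congr 1
            have := hc.symm.sub_one_mul_conj
            linarith
        _ = _ := by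
            rw [lintegral_const_mul']
            exact ENNReal.rpow_ne_top_of_nonneg (by have := hc.pos; positivity) hfin
    set A := ∫⁻ x, H x ^ q ∂μ
    by_cases hA0 : A = 0
    · simp [hA0]
    have hA : A = A ^ (1 / q') * A ^ (1 / q) := by
      rw [← ENNReal.rpow_add _ _ hA0 hfin]
      have := hc.inv_add_inv_eq_one
      rw [one_div, one_div, this, ENNReal.rpow_one]
    have h2 : A ^ (1 / q) ≤ R := by
      rw [hA] at h1
      have hne : A ^ (1 / q') ≠ 0 := by
        simp [ENNReal.rpow_eq_zero_iff, hA0, hfin]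
      have hnt : A ^ (1 / q') ≠ ∞ :=
        ENNReal.rpow_ne_top_of_nonneg (by have := hc.pos; positivity) hfin
      have h3 : A ^ (1 / q') * A ^ (1 / q) ≤ A ^ (1 / q') * R := by
        refine h1.trans (le_of_eq ?_)
        rw [← hA]
      exact (ENNReal.mul_le_mul_iff_right hne hnt).1 h3
    calc A = (A ^ (1 / q)) ^ q := by
          rw [← ENNReal.rpow_mul, one_div, inv_mul_cancel₀ hq0.ne', ENNReal.rpow_one]
      _ ≤ R ^ q := ENNReal.rpow_le_rpow h2 hq0.le
  suffices h : ∫⁻ x, G x ^ q ∂μ ≤ R ^ q by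
    calc (∫⁻ x, G x ^ q ∂μ) ^ (1 / q) ≤ (R ^ q) ^ (1 / q) :=
          ENNReal.rpow_le_rpow h (by positivity)
      _ = R := by rw [← ENNReal.rpow_mul, mul_one_div, div_self hq0.ne', ENNReal.rpow_one]
  set H : ℕ → α → ℝ≥0∞ := fun n => (spanningSets μ n).indicator fun x => min (G x) n with hH
  have hHm : ∀ n, Measurable (H n) := fun n =>
    (hGm.min measurable_const).indicator (measurableSet_spanningSets μ n)
  have hmono : ∀ x, Monotone fun n => H n x := by
    intro x n m hnm
    refine (Set.indicator_le_indicator_of_subset (monotone_spanningSets μ hnm)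
      (fun _ => zero_le) x).trans ?_
    refine Set.indicator_le_indicator ?_
    gcongr
  have hsup : ∀ x, ⨆ n, H n x = G x := by
    intro x
    apply le_antisymm
    · exact iSup_le fun n => Set.indicator_apply_le' (fun _ => min_le_left _ _) fun _ => zero_le
    · refine le_of_forall_lt fun c hc => ?_
      obtain ⟨n, hn⟩ := ENNReal.exists_nat_gt hc.ne_top
      obtain ⟨m, hm⟩ : ∃ m, x ∈ spanningSets μ m := by
        have := iUnion_spanningSets μ
        exact Set.mem_iUnion.1 (this ▸ Set.mem_univ x)
      refine lt_of_lt_of_le ?_ (le_iSup _ (max n m))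
      rw [hH]
      simp only
      rw [Set.indicator_of_mem (monotone_spanningSets μ (le_max_right n m) hm)]
      exact lt_min hc (hn.trans_le (by exact_mod_cast le_max_left n m))
  have : ∫⁻ x, G x ^ q ∂μ = ⨆ n, ∫⁻ x, H n x ^ q ∂μ := by
    rw [← lintegral_iSup (fun n => (hHm n).pow_const q)
      (fun n m hnm x => ENNReal.rpow_le_rpow (hmono x hnm) hq0.le)]
    refine lintegral_congr fun x => ?_
    rw [← hsup x]
    exact (ENNReal.orderIsoRpow q hq0).map_iSup _
  rw [this]
  refine iSup_le fun n => key _ (hHm n) (fun x => hsup x ▸ le_iSup (fun n => H n x) n) ?_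
  have h4 : ∫⁻ x, H n x ^ q ∂μ ≤ ∫⁻ x in spanningSets μ n, (n : ℝ≥0∞) ^ q ∂μ := by
    rw [← lintegral_indicator (measurableSet_spanningSets μ n)]
    refine lintegral_mono fun x => ?_
    by_cases hx : x ∈ spanningSets μ n
    · simp only [hH, Set.indicator_of_mem hx]
      gcongr
      exact min_le_right _ _
    · simp [hH, Set.indicator_of_notMem hx, hq0]
  refine ne_top_of_le_ne_top ?_ h4
  rw [setLIntegral_const]
  exact ENNReal.mul_ne_top (ENNReal.rpow_ne_top_of_nonneg hq0.le (by simp))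
    (measure_spanningSets_lt_top μ n).ne

/-- Minkowski's integral inequality for Bochner integrals. -/
theorem eLpNorm_integral_le {α β E : Type*} [MeasurableSpace α] [MeasurableSpace β]
    [NormedAddCommGroup E] [NormedSpace ℝ E]
    {μ : Measure α} {ν : Measure β} [SigmaFinite μ] [SigmaFinite ν] {q : ℝ≥0∞} (hq : 1 ≤ q)
    (hq' : q ≠ ∞) {F : α → β → E} (hF : StronglyMeasurable (Function.uncurry F)) :
    eLpNorm (fun x => ∫ y, F x y ∂ν) q μ ≤ ∫⁻ y, eLpNorm (fun x => F x y) q μ ∂ν := by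
  have hq0 : q ≠ 0 := (zero_lt_one.trans_le hq).ne'
  have h1 : 1 ≤ q.toReal := by
    simpa using (ENNReal.toReal_le_toReal ENNReal.one_ne_top hq').2 hq
  simp only [eLpNorm_eq_lintegral_rpow_enorm_toReal hq0 hq']
  refine le_trans ?_ (lintegral_rpow_lintegral_le h1 (F := fun x y => ‖F x y‖ₑ) hF.enorm)
  refine ENNReal.rpow_le_rpow (lintegral_mono fun x => ?_) (by positivity)
  exact ENNReal.rpow_le_rpow (enorm_integral_le_lintegral_enorm _) (by positivity)

/-- Interpolation of `L^p` between `L^{p/2}` and `L^∞`. -/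
theorem eLpNorm_sq_le_of_bound {α E : Type*} [MeasurableSpace α] [NormedAddCommGroup E]
    {μ : Measure α} {p : ℝ} (hp : 0 < p) {f : α → E}
    (hf : AEStronglyMeasurable f μ) {B : ℝ≥0∞} (hB : ∀ x, ‖f x‖ₑ ≤ B) :
    eLpNorm f (ENNReal.ofReal p) μ ^ 2 ≤ B * eLpNorm f (ENNReal.ofReal (p / 2)) μ := by
  have h0 : ENNReal.ofReal p ≠ 0 := by simpa using hp
  have h0' : ENNReal.ofReal (p / 2) ≠ 0 := by simpa using hp
  rw [eLpNorm_eq_lintegral_rpow_enorm_toReal h0 ENNReal.ofReal_ne_top,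
    eLpNorm_eq_lintegral_rpow_enorm_toReal h0' ENNReal.ofReal_ne_top,
    ENNReal.toReal_ofReal hp.le, ENNReal.toReal_ofReal (by positivity), ← ENNReal.rpow_natCast,
    ← ENNReal.rpow_mul]
  have : ∫⁻ x, ‖f x‖ₑ ^ p ∂μ ≤ B ^ (p / 2) * ∫⁻ x, ‖f x‖ₑ ^ (p / 2) ∂μ := by
    refine le_trans (lintegral_mono fun x => ?_)
      (lintegral_const_mul'' _ (hf.enorm.pow_const _)).le
    calc ‖f x‖ₑ ^ p = ‖f x‖ₑ ^ (p / 2) * ‖f x‖ₑ ^ (p / 2) := by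
          rw [← ENNReal.rpow_add_of_nonneg _ _ (by positivity) (by positivity)]
          congr 1; ring
      _ ≤ _ := by gcongr; exact hB x
  calc _ ≤ (B ^ (p / 2) * ∫⁻ x, ‖f x‖ₑ ^ (p / 2) ∂μ) ^ (1 / p * ((2 : ℕ) : ℝ)) :=
        ENNReal.rpow_le_rpow this (by positivity)
    _ = _ := by
        have e : 1 / p * ((2 : ℕ) : ℝ) = 1 / (p / 2) := by push_cast; field_simp
        rw [e, ENNReal.mul_rpow_of_nonneg _ _ (by positivity), ← ENNReal.rpow_mul,
          mul_one_div, div_self (by positivity), ENNReal.rpow_one]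

end

section

/-! ### Dyadic weights -/

/-- The dyadic weight `2 ^ x` as an extended nonnegative real. -/
def dyadicWeight (x : ℝ) : ℝ≥0∞ := ENNReal.ofReal ((2 : ℝ) ^ x)

theorem dyadicWeight_add (x y : ℝ) :
    dyadicWeight (x + y) = dyadicWeight x * dyadicWeight y := by
  rw [dyadicWeight, Real.rpow_add two_pos, ENNReal.ofReal_mul (by positivity)]
  rfl

theorem dyadicWeight_ne_top (x : ℝ) : dyadicWeight x ≠ ∞ := ENNReal.ofReal_ne_top

theorem dyadicWeight_zero : dyadicWeight 0 = 1 := by simp [dyadicWeight]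

theorem dyadicWeight_mono {x y : ℝ} (h : x ≤ y) : dyadicWeight x ≤ dyadicWeight y :=
  ENNReal.ofReal_le_ofReal (Real.rpow_le_rpow_of_exponent_le one_le_two h)

/-! ### Dilated Fourier multipliers -/

variable {V : Type*} [NormedAddCommGroup V] [InnerProductSpace ℝ V]
    [FiniteDimensional ℝ V] [MeasurableSpace V] [BorelSpace V]

omit [FiniteDimensional ℝ V] [MeasurableSpace V] [BorelSpace V] in
theorem hasTemperateGrowth_dilation (c : ℝ) (m : 𝓢(V, ℂ)) :
    (fun ξ : V => m (c • ξ)).HasTemperateGrowth :=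
  m.hasTemperateGrowth.comp
    (ContinuousLinearMap.hasTemperateGrowth (c • ContinuousLinearMap.id ℝ V))

/-- The convolution kernel of the Fourier multiplier with symbol `m`. -/
def multiplierKernel (m : 𝓢(V, ℂ)) : 𝓢(V, ℂ) := 𝓕⁻ m

/-- The Fourier multiplier with symbol `m (2^{-k} ξ)`. -/
def dyadicMultiplier (k : ℤ) (m f : 𝓢(V, ℂ)) : 𝓢(V, ℂ) :=
  fourierMultiplierCLM ℂ (fun ξ : V => m ((2 : ℝ) ^ (-k) • ξ)) f

theorem dyadicMultiplier_apply (k : ℤ) (m f : 𝓢(V, ℂ)) (x : V) :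
    dyadicMultiplier k m f x =
      𝓕⁻ (fun ξ : V => m ((2 : ℝ) ^ (-k) • ξ) * 𝓕 (f : V → ℂ) ξ) x := by
  rw [dyadicMultiplier, fourierMultiplierCLM_apply, fourierInv_coe]
  refine congrArg (fun g : V → ℂ => 𝓕⁻ g x) (funext fun ξ => ?_)
  rw [smulLeftCLM_apply_apply (hasTemperateGrowth_dilation _ m), fourier_coe, smul_eq_mul]

theorem dyadicMultiplier_eq_convolution (k : ℤ) (m f : 𝓢(V, ℂ)) (x : V) :
    dyadicMultiplier k m f x = ∫ z, multiplierKernel m z * f (x - (2 : ℝ) ^ (-k) • z) := by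
  set a : ℝ := (2 : ℝ) ^ (-k)
  set g : V → ℂ := fun ξ => Real.fourierChar (inner ℝ ξ x) • 𝓕 f ξ
  have hg : Integrable g := by
    refine (𝓕 f).integrable.norm.mono' ?_ (ae_of_all _ fun ξ => ?_)
    · refine Continuous.aestronglyMeasurable ?_
      have := (𝓕 f).continuous
      have := Real.continuous_fourierChar
      fun_prop
    · simp only [g, Circle.norm_smul]
      exact le_rfl
  have h := VectorFourier.integral_fourierIntegral_smul_eq_flip (e := Real.fourierChar)
    (μ := (volume : Measure V)) (ν := (volume : Measure V)) (L := a • innerₗ V)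
    (f := multiplierKernel m) (g := g) Real.continuous_fourierChar
    (by simp only [LinearMap.smul_apply, innerₗ_apply_apply]; fun_prop)
    (multiplierKernel m).integrable hg
  have h1 : ∀ ξ, VectorFourier.fourierIntegral Real.fourierChar volume (a • innerₗ V)
      (multiplierKernel m) ξ =
      m (a • ξ) := by
    intro ξ
    have : m (a • ξ) = (𝓕 (multiplierKernel m) : 𝓢(V, ℂ)) (a • ξ) := by
      rw [multiplierKernel, FourierTransform.fourier_fourierInv_eq]
    rw [this, fourier_coe, Real.fourier_eq]
    simp only [VectorFourier.fourierIntegral, LinearMap.smul_apply, innerₗ_apply_apply,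
      inner_smul_right, smul_eq_mul]
  have h2 : ∀ z, VectorFourier.fourierIntegral Real.fourierChar volume (a • innerₗ V).flip g z =
      f (x - a • z) := by
    intro z
    have : f (x - a • z) = (𝓕⁻ (𝓕 f) : 𝓢(V, ℂ)) (x - a • z) := by
      rw [FourierTransform.fourierInv_fourier_eq]
    rw [this, fourierInv_coe, Real.fourierInv_eq]
    simp only [VectorFourier.fourierIntegral, LinearMap.flip_apply, LinearMap.smul_apply,
      innerₗ_apply_apply, g, smul_smul]
    refine integral_congr_ae (ae_of_all _ fun ξ => ?_)
    simp only
    rw [← AddChar.map_add_eq_mul]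
    congr 2
    rw [inner_sub_right, inner_smul_right, real_inner_comm z ξ, smul_eq_mul]
    ring
  rw [dyadicMultiplier_apply, Real.fourierInv_eq]
  simp only [h1, h2, smul_eq_mul] at h
  rw [← h]
  refine integral_congr_ae (ae_of_all _ fun ξ => ?_)
  simp only [g, fourier_coe, a, Circle.smul_def, smul_eq_mul]
  ring

theorem eLpNorm_dyadicMultiplier_le (k : ℤ) (m f : 𝓢(V, ℂ)) {q : ℝ≥0∞} (hq : 1 ≤ q)
    (hq' : q ≠ ∞) :
    eLpNorm (dyadicMultiplier k m f) q volume ≤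
      eLpNorm (multiplierKernel m) 1 volume * eLpNorm f q volume := by
  have h0 : (dyadicMultiplier k m f : V → ℂ) =
      fun x => ∫ z, multiplierKernel m z * f (x - (2 : ℝ) ^ (-k) • z) :=
    funext fun x => dyadicMultiplier_eq_convolution k m f x
  rw [h0]
  refine (eLpNorm_integral_le hq hq' ?_).trans ?_
  · have := (multiplierKernel m).continuous
    have := f.continuous
    refine Continuous.stronglyMeasurable ?_
    simp only [Function.uncurry_def]
    fun_prop
  · rw [eLpNorm_one_eq_lintegral_enorm]
    rw [← lintegral_mul_const _ (multiplierKernel m).continuous.enorm.measurable]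
    refine lintegral_mono fun z => ?_
    have h1 := eLpNorm_const_smul (multiplierKernel m z)
      (fun x => f (x - (2 : ℝ) ^ (-k) • z)) q volume
    have h2 : eLpNorm (fun x => f (x - (2 : ℝ) ^ (-k) • z)) q volume = eLpNorm f q volume :=
      eLpNorm_comp_measurePreserving (g := f) f.continuous.aestronglyMeasurable
        (measurePreserving_sub_right volume _)
    rw [h2] at h1
    exact h1.le

theorem eLpNorm_comp_sub_zpow_smul (k : ℤ) (x : V) (f : 𝓢(V, ℂ)) {q : ℝ≥0∞}
    (hq' : q ≠ ∞) :
    eLpNorm (fun z => f (x - (2 : ℝ) ^ (-k) • z)) q volume =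
      dyadicWeight (k * (Module.finrank ℝ V / q.toReal)) * eLpNorm f q volume := by
  set a : ℝ := (2 : ℝ) ^ (-k)
  have ha : a ≠ 0 := by positivity
  have h1 : eLpNorm (fun z => f (x - a • z)) q volume =
      eLpNorm (fun y => f (x - y)) q (Measure.map (fun z : V => a • z) volume) := by
    rw [eLpNorm_map_measure]
    · rfl
    · have := f.continuous
      exact Continuous.aestronglyMeasurable (by fun_prop)
    · fun_prop
  rw [h1, Measure.map_addHaar_smul _ ha, eLpNorm_smul_measure_of_ne_top hq']
  have h2 : eLpNorm (fun y => f (x - y)) q volume = eLpNorm f q volume :=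
    eLpNorm_comp_measurePreserving (g := f) f.continuous.aestronglyMeasurable
      (Measure.measurePreserving_sub_left volume x)
  rw [h2, smul_eq_mul]
  congr 1
  rw [ENNReal.ofReal_rpow_of_nonneg (abs_nonneg _) (by positivity), dyadicWeight]
  congr 1
  have h3 : |(a ^ Module.finrank ℝ V)⁻¹| = (2 : ℝ) ^ ((k : ℝ) * Module.finrank ℝ V) := by
    rw [abs_of_pos (by positivity), Real.rpow_mul two_pos.le, Real.rpow_intCast,
      Real.rpow_natCast, ← inv_pow]
    congr 1
    simp [a]
  rw [h3, ← Real.rpow_mul two_pos.le]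
  congr 1
  simp
  ring

theorem enorm_dyadicMultiplier_le (k : ℤ) (m f : 𝓢(V, ℂ)) {q : ℝ≥0∞} (hq : 1 ≤ q)
    (hq' : q ≠ ∞) (x : V) :
    ‖dyadicMultiplier k m f x‖ₑ ≤ eLpNorm (multiplierKernel m) q.conjExponent volume *
      (dyadicWeight (k * (Module.finrank ℝ V / q.toReal)) * eLpNorm f q volume) := by
  rw [← eLpNorm_comp_sub_zpow_smul k x f hq', dyadicMultiplier_eq_convolution]
  refine (enorm_integral_le_lintegral_enorm _).trans ?_
  rw [← eLpNorm_one_eq_lintegral_enorm]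
  have : ENNReal.HolderConjugate q.conjExponent q :=
    (ENNReal.HolderConjugate.conjExponent hq).symm
  refine eLpNorm_smul_le_mul_eLpNorm (φ := multiplierKernel m)
    (f := fun z => f (x - (2 : ℝ) ^ (-k) • z))
    ?_ (multiplierKernel m).continuous.aestronglyMeasurable
  have := f.continuous
  exact Continuous.aestronglyMeasurable (by fun_prop)

end

section

/-! ### Littlewood–Paley blocks of Schwartz functions -/

variable {V : Type*} [NormedAddCommGroup V] [InnerProductSpace ℝ V]
    [FiniteDimensional ℝ V] [MeasurableSpace V] [BorelSpace V]

theorem schwartz_ext_fourier {f g : 𝓢(V, ℂ)}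
    (h : ∀ ξ, (𝓕 f : 𝓢(V, ℂ)) ξ = (𝓕 g : 𝓢(V, ℂ)) ξ) : f = g := by
  have h1 : (𝓕 f : 𝓢(V, ℂ)) = 𝓕 g := SchwartzMap.ext h
  rw [← FourierTransform.fourierInv_fourier_eq (F := 𝓢(V, ℂ)) f, h1,
    FourierTransform.fourierInv_fourier_eq]

theorem fourier_dyadicMultiplier (k : ℤ) (m f : 𝓢(V, ℂ)) (ξ : V) :
    (𝓕 (dyadicMultiplier k m f) : 𝓢(V, ℂ)) ξ =
      m ((2 : ℝ) ^ (-k) • ξ) * (𝓕 f : 𝓢(V, ℂ)) ξ := by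
  rw [dyadicMultiplier, fourierMultiplierCLM_apply, FourierTransform.fourier_fourierInv_eq,
    smulLeftCLM_apply_apply (hasTemperateGrowth_dilation _ m), smul_eq_mul]

theorem fourier_lineDeriv_apply (f : 𝓢(V, ℂ)) (e ξ : V) :
    (𝓕 (LineDeriv.lineDerivOp e f) : 𝓢(V, ℂ)) ξ =
      2 * Real.pi * Complex.I * (inner ℝ ξ e : ℝ) * (𝓕 f : 𝓢(V, ℂ)) ξ := by
  rw [fourier_lineDerivOp_eq]
  simp [smulLeftCLM_apply_apply (Function.hasTemperateGrowth_inner_left e), mul_assoc]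

/-- The pointwise product of two Schwartz functions. -/
def schwartzMul (f g : 𝓢(V, ℂ)) : 𝓢(V, ℂ) := pairing (ContinuousLinearMap.mul ℂ ℂ) f g

omit [FiniteDimensional ℝ V] [MeasurableSpace V] [BorelSpace V] in
@[simp]
theorem schwartzMul_apply (f g : 𝓢(V, ℂ)) (x : V) : schwartzMul f g x = f x * g x := rfl

theorem fourier_fourier_apply (f : 𝓢(V, ℂ)) (x : V) :
    (𝓕 (𝓕 f : 𝓢(V, ℂ)) : 𝓢(V, ℂ)) x = f (-x) := by
  have h : f (-x) = (𝓕⁻ (𝓕 f) : 𝓢(V, ℂ)) (-x) := by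
    rw [FourierTransform.fourierInv_fourier_eq]
  rw [h, fourierInv_coe, fourier_coe, Real.fourierInv_eq_fourier_neg, neg_neg]

theorem fourier_schwartzMul (f g : 𝓢(V, ℂ)) (ξ : V) :
    (𝓕 (schwartzMul f g) : 𝓢(V, ℂ)) ξ =
      ∫ η, (𝓕 f : 𝓢(V, ℂ)) η * (𝓕 g : 𝓢(V, ℂ)) (ξ - η) := by
  have h : (𝓕 (schwartzMul f g) : 𝓢(V, ℂ)) =
      SchwartzMap.convolution (ContinuousLinearMap.mul ℂ ℂ) (𝓕 f) (𝓕 g) := by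
    refine schwartz_ext_fourier fun x => ?_
    rw [fourier_convolution, fourier_fourier_apply, pairing_apply_apply,
      fourier_fourier_apply, fourier_fourier_apply]
    rfl
  rw [h, SchwartzMap.convolution_apply]
  rfl

omit [FiniteDimensional ℝ V] [MeasurableSpace V] [BorelSpace V] in
/-- The Schwartz function `c g` for a smooth compactly supported real function `g`. -/
def realSymbol (c : ℂ) (g : V → ℝ) (hc : HasCompactSupport g) (hg : ContDiff ℝ (⊤ : ℕ∞) g) :
    𝓢(V, ℂ) :=
  c • HasCompactSupport.toSchwartzMap (f := fun ξ => (g ξ : ℂ))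
    (hc.comp_left Complex.ofReal_zero) (Complex.ofRealCLM.contDiff.comp hg)

omit [FiniteDimensional ℝ V] [MeasurableSpace V] [BorelSpace V] in
theorem realSymbol_apply (c : ℂ) (g : V → ℝ) (hc : HasCompactSupport g)
    (hg : ContDiff ℝ (⊤ : ℕ∞) g) (ξ : V) : realSymbol c g hc hg ξ = c * g ξ := rfl

namespace MHD.LPF

variable (χ : LPF V)

theorem chi_le_one (x : V) : χ.chi x ≤ 1 := by
  rw [← χ.eq_one 0 (by simp)]
  exact χ.radial_antitone 0 x (by simp)

theorem phiHat_eq_zero_of_le {ξ : V} (h : ‖ξ‖ ≤ 1) : χ.phiHat ξ = 0 := by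
  rw [phiHat, χ.eq_one ξ h, χ.eq_one _ (by rw [norm_smul]; norm_num; linarith), sub_self]

theorem phiHat_eq_zero_of_ge {ξ : V} (h : 4 ≤ ‖ξ‖) : χ.phiHat ξ = 0 := by
  rw [phiHat, χ.supp ξ (by linarith), χ.supp _ (by rw [norm_smul]; norm_num; linarith), sub_self]

theorem contDiff_phiHat : ContDiff ℝ (⊤ : ℕ∞) χ.phiHat := by
  have := χ.smooth
  unfold phiHat
  fun_prop

theorem hasCompactSupport_phiHat : HasCompactSupport χ.phiHat := by
  refine HasCompactSupport.intro (isCompact_closedBall (0 : V) 4) fun x hx =>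
    χ.phiHat_eq_zero_of_ge ?_
  simp only [Metric.mem_closedBall, dist_zero_right, not_le] at hx
  exact hx.le

/-- The Littlewood–Paley symbol `φ̂` as a complex Schwartz function. -/
def phiSymbol : 𝓢(V, ℂ) :=
  realSymbol 1 χ.phiHat χ.hasCompactSupport_phiHat χ.contDiff_phiHat

@[simp]
theorem phiSymbol_apply (ξ : V) : χ.phiSymbol ξ = χ.phiHat ξ := by
  rw [phiSymbol, realSymbol_apply, one_mul]

/-- The `k`-th Littlewood–Paley block on Schwartz functions. -/
def blockS (k : ℤ) (f : 𝓢(V, ℂ)) : 𝓢(V, ℂ) := dyadicMultiplier k χ.phiSymbol f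

theorem block_eq (k : ℤ) (f : 𝓢(V, ℂ)) : χ.block k f = χ.blockS k f := by
  funext x
  rw [blockS, dyadicMultiplier_apply]
  simp only [phiSymbol_apply]
  rfl

theorem fourier_blockS (k : ℤ) (f : 𝓢(V, ℂ)) (ξ : V) :
    (𝓕 (χ.blockS k f) : 𝓢(V, ℂ)) ξ =
      (χ.phiHat ((2 : ℝ) ^ (-k) • ξ) : ℂ) * (𝓕 f : 𝓢(V, ℂ)) ξ := by
  rw [blockS, fourier_dyadicMultiplier, phiSymbol_apply]

theorem fourier_blockS_eq_zero_of_le {k : ℤ} (f : 𝓢(V, ℂ)) {ξ : V} (h : ‖ξ‖ ≤ 2 ^ k) :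
    (𝓕 (χ.blockS k f) : 𝓢(V, ℂ)) ξ = 0 := by
  rw [fourier_blockS, χ.phiHat_eq_zero_of_le]
  · simp
  · rw [norm_smul, zpow_neg, norm_inv, norm_zpow, Real.norm_ofNat,
      inv_mul_le_iff₀ (by positivity), mul_one]
    exact h

theorem fourier_blockS_eq_zero_of_ge {k : ℤ} (f : 𝓢(V, ℂ)) {ξ : V} (h : 4 * 2 ^ k ≤ ‖ξ‖) :
    (𝓕 (χ.blockS k f) : 𝓢(V, ℂ)) ξ = 0 := by
  rw [fourier_blockS, χ.phiHat_eq_zero_of_ge]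
  · simp
  · rw [norm_smul, zpow_neg, norm_inv, norm_zpow, Real.norm_ofNat,
      le_inv_mul_iff₀ (by positivity), mul_comm]
    exact h

/-- A cutoff equal to one on the support of `φ̂`. -/
def fatHat (ξ : V) : ℝ := χ.chi ((4 : ℝ)⁻¹ • ξ) - χ.chi ((2 : ℝ) • ξ)

theorem fatHat_eq_one {ξ : V} (h1 : 1 ≤ ‖ξ‖) (h4 : ‖ξ‖ ≤ 4) : χ.fatHat ξ = 1 := by
  rw [fatHat, χ.eq_one, χ.supp]
  · simp
  · rw [norm_smul]; norm_num; linarith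
  · rw [norm_smul]; norm_num; linarith

theorem fatHat_eq_zero_of_le {ξ : V} (h : ‖ξ‖ ≤ 1 / 2) : χ.fatHat ξ = 0 := by
  rw [fatHat, χ.eq_one, χ.eq_one, sub_self]
  · rw [norm_smul]; norm_num; linarith
  · rw [norm_smul]; norm_num; linarith

theorem fatHat_eq_zero_of_ge {ξ : V} (h : 8 ≤ ‖ξ‖) : χ.fatHat ξ = 0 := by
  rw [fatHat, χ.supp, χ.supp, sub_self]
  · rw [norm_smul]; norm_num; linarith
  · rw [norm_smul]; norm_num; linarith

theorem contDiff_fatHat : ContDiff ℝ (⊤ : ℕ∞) χ.fatHat := by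
  have := χ.smooth
  unfold fatHat
  fun_prop

theorem hasCompactSupport_fatHat : HasCompactSupport χ.fatHat := by
  refine HasCompactSupport.intro (isCompact_closedBall (0 : V) 8) fun x hx =>
    χ.fatHat_eq_zero_of_ge ?_
  simp only [Metric.mem_closedBall, dist_zero_right, not_le] at hx
  exact hx.le

theorem fatHat_mul_phiHat (ξ : V) : χ.fatHat ξ * χ.phiHat ξ = χ.phiHat ξ := by
  rcases le_total ‖ξ‖ 1 with h1 | h1
  · simp [χ.phiHat_eq_zero_of_le h1]
  rcases le_total ‖ξ‖ 4 with h4 | h4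
  · simp [χ.fatHat_eq_one h1 h4]
  · simp [χ.phiHat_eq_zero_of_ge h4]

/-- The cutoff `fatHat` as a complex Schwartz function. -/
def fatSymbol : 𝓢(V, ℂ) :=
  realSymbol 1 χ.fatHat χ.hasCompactSupport_fatHat χ.contDiff_fatHat

/-- The localized symbol of the derivative in the direction `e`. -/
def derivSymbol (e : V) : 𝓢(V, ℂ) :=
  realSymbol (2 * Real.pi * Complex.I) (fun ξ => inner ℝ ξ e * χ.fatHat ξ)
    χ.hasCompactSupport_fatHat.mul_left
    ((contDiff_id.inner ℝ contDiff_const).mul χ.contDiff_fatHat)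

theorem contDiff_inner_div_mul_fatHat (e : V) :
    ContDiff ℝ (⊤ : ℕ∞) fun ξ : V => inner ℝ ξ e / ‖ξ‖ ^ 2 * χ.fatHat ξ := by
  rw [contDiff_iff_contDiffAt]
  intro ξ
  by_cases hξ : ξ = 0
  · have : (fun ξ : V => inner ℝ ξ e / ‖ξ‖ ^ 2 * χ.fatHat ξ) =ᶠ[𝓝 ξ] fun _ => 0 := by
      filter_upwards [Metric.ball_mem_nhds ξ (show (0 : ℝ) < 1 / 2 by norm_num)] with y hy
      rw [hξ, Metric.mem_ball, dist_zero_right] at hy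
      rw [χ.fatHat_eq_zero_of_le hy.le, mul_zero]
    exact contDiffAt_const.congr_of_eventuallyEq this
  · have h := χ.contDiff_fatHat.contDiffAt (x := ξ)
    have h2 : ContDiffAt ℝ (⊤ : ℕ∞) (fun ξ : V => ‖ξ‖ ^ 2) ξ :=
      (contDiff_norm_sq ℝ).contDiffAt
    refine ContDiffAt.mul (ContDiffAt.div
      (contDiff_id.inner ℝ contDiff_const).contDiffAt h2 ?_) h
    simpa using hξ

theorem hasCompactSupport_inner_div_mul_fatHat (e : V) :
    HasCompactSupport fun ξ : V => inner ℝ ξ e / ‖ξ‖ ^ 2 * χ.fatHat ξ :=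
  HasCompactSupport.mul_left (f := fun ξ : V => inner ℝ ξ e / ‖ξ‖ ^ 2) χ.hasCompactSupport_fatHat

/-- The localized symbol inverting the derivative in the direction `e`. -/
def antiderivSymbol (e : V) : 𝓢(V, ℂ) :=
  realSymbol (2 * Real.pi * Complex.I)⁻¹ (fun ξ => inner ℝ ξ e / ‖ξ‖ ^ 2 * χ.fatHat ξ)
    (χ.hasCompactSupport_inner_div_mul_fatHat e) (χ.contDiff_inner_div_mul_fatHat e)

theorem dyadicMultiplier_fatSymbol_blockS (k : ℤ) (f : 𝓢(V, ℂ)) :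
    dyadicMultiplier k χ.fatSymbol (χ.blockS k f) = χ.blockS k f := by
  refine schwartz_ext_fourier fun ξ => ?_
  rw [fourier_dyadicMultiplier, fourier_blockS, ← mul_assoc]
  congr 1
  rw [fatSymbol, realSymbol_apply, one_mul]
  exact_mod_cast χ.fatHat_mul_phiHat _

theorem blockS_lineDeriv (k : ℤ) (e : V) (f : 𝓢(V, ℂ)) :
    χ.blockS k (LineDeriv.lineDerivOp e f) =
      ((2 : ℂ) ^ k) • dyadicMultiplier k (χ.derivSymbol e) (χ.blockS k f) := by
  refine schwartz_ext_fourier fun ξ => ?_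
  rw [FourierTransform.fourier_smul, smul_apply, fourier_dyadicMultiplier, fourier_blockS,
    fourier_blockS, fourier_lineDeriv_apply]
  set η := (2 : ℝ) ^ (-k) • ξ with hη
  have h1 : ξ = (2 : ℝ) ^ k • η := by
    rw [hη, smul_smul, zpow_neg, mul_inv_cancel₀ (by positivity), one_smul]
  have h2 : (χ.fatHat η : ℂ) * χ.phiHat η = χ.phiHat η := by exact_mod_cast χ.fatHat_mul_phiHat η
  rw [derivSymbol, realSymbol_apply, smul_eq_mul]
  nth_rw 1 [h1]
  rw [inner_smul_left, ← h2]
  simp only [Complex.ofReal_mul, Complex.ofReal_zpow, Complex.ofReal_ofNat, RCLike.conj_to_real]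
  linear_combination (-(2 * Real.pi * Complex.I * 2 ^ k * (inner ℝ η e : ℝ) *
    (𝓕 f : 𝓢(V, ℂ)) ξ)) * ((χ.fatHat η : ℂ) * h2)

theorem blockS_eq_sum_antideriv {ι : Type*} [Fintype ι] (b : OrthonormalBasis ι ℝ V) (k : ℤ)
    (f : 𝓢(V, ℂ)) :
    χ.blockS k f = ((2 : ℂ) ^ (-k)) • ∑ i, dyadicMultiplier k (χ.antiderivSymbol (b i))
      (χ.blockS k (LineDeriv.lineDerivOp (b i) f)) := by
  refine schwartz_ext_fourier fun ξ => ?_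
  rw [FourierTransform.fourier_smul, smul_apply, FourierTransform.fourier_sum, sum_apply]
  simp only [fourier_dyadicMultiplier, fourier_blockS, fourier_lineDeriv_apply]
  set η := (2 : ℝ) ^ (-k) • ξ with hη
  have h1 : ξ = (2 : ℝ) ^ k • η := by
    rw [hη, smul_smul, zpow_neg, mul_inv_cancel₀ (by positivity), one_smul]
  have h2 : (χ.fatHat η : ℂ) * χ.phiHat η = χ.phiHat η := by exact_mod_cast χ.fatHat_mul_phiHat η
  by_cases hη0 : η = 0
  · have : χ.phiHat η = 0 := χ.phiHat_eq_zero_of_le (by simp [hη0])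
    simp [this]
  have h3 : ∑ i, ((inner ℝ η (b i) : ℝ) : ℂ) ^ 2 = ((‖η‖ : ℝ) : ℂ) ^ 2 := by
    exact_mod_cast b.sum_sq_inner_left η
  have h4 : ((‖η‖ : ℝ) : ℂ) ≠ 0 := by simpa using hη0
  have h5 : ∀ i, χ.antiderivSymbol (b i) η * ((χ.phiHat η : ℂ) *
      (2 * Real.pi * Complex.I * (inner ℝ ξ (b i) : ℝ) * (𝓕 f : 𝓢(V, ℂ)) ξ)) =
      ((inner ℝ η (b i) : ℝ) : ℂ) ^ 2 *
        ((2 : ℂ) ^ k * (((‖η‖ : ℝ) : ℂ) ^ 2)⁻¹ * ((χ.phiHat η : ℂ) * (𝓕 f : 𝓢(V, ℂ)) ξ)) := by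
    intro i
    have h6 : ((inner ℝ ξ (b i) : ℝ) : ℂ) = 2 ^ k * ((inner ℝ η (b i) : ℝ) : ℂ) := by
      rw [h1, inner_smul_left]
      simp
    have hpi : (2 * Real.pi * Complex.I : ℂ) ≠ 0 := Complex.two_pi_I_ne_zero
    rw [antiderivSymbol, realSymbol_apply, h6]
    simp only [Complex.ofReal_mul, Complex.ofReal_div, Complex.ofReal_pow]
    generalize hc : (2 * Real.pi * Complex.I : ℂ) = c at hpi ⊢
    field_simp
    linear_combination (((inner ℝ η (b i) : ℝ) : ℂ) ^ 2 *
       (𝓕 f : 𝓢(V, ℂ)) ξ) * h2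
  rw [Finset.sum_congr rfl fun i _ => h5 i, ← Finset.sum_mul, h3, smul_eq_mul, zpow_neg]
  field_simp

end MHD.LPF

end

/-! ### Bernstein inequalities and frequency supports of products -/

section Bernstein

variable {V : Type*} [NormedAddCommGroup V] [InnerProductSpace ℝ V]
    [FiniteDimensional ℝ V] [MeasurableSpace V] [BorelSpace V]

theorem eLpNorm_multiplierKernel_ne_top (m : 𝓢(V, ℂ)) (q : ℝ≥0∞) :
    eLpNorm (multiplierKernel m) q volume ≠ ∞ := by
  have h := (multiplierKernel m).memLp q (volume : Measure V)
  exact h.2.ne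

theorem eLpNorm_schwartzMul_le_of_bound (f g : 𝓢(V, ℂ)) {B : ℝ≥0∞} (hB : ∀ x, ‖f x‖ₑ ≤ B)
    (q : ℝ≥0∞) : eLpNorm (schwartzMul f g) q volume ≤ B * eLpNorm g q volume := by
  have h := eLpNorm_smul_le_eLpNorm_top_mul_eLpNorm (μ := (volume : Measure V)) q
    (f := g) g.continuous.aestronglyMeasurable (φ := f)
  have h1 : eLpNorm f ∞ (volume : Measure V) ≤ B := by
    rw [eLpNorm_exponent_top]
    exact eLpNormEssSup_le_of_ae_enorm_bound (Eventually.of_forall hB)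
  exact h.trans (mul_le_mul_left h1 _)

omit [FiniteDimensional ℝ V] [MeasurableSpace V] [BorelSpace V] in
theorem schwartzMul_comm (f g : 𝓢(V, ℂ)) : schwartzMul f g = schwartzMul g f := by
  ext x
  simp [mul_comm]

theorem eLpNorm_schwartzMul_half_le (f g : 𝓢(V, ℂ)) {p : ℝ} (hp : 0 < p) :
    eLpNorm (schwartzMul f g) (ENNReal.ofReal (p / 2)) volume ≤
      eLpNorm f (ENNReal.ofReal p) volume * eLpNorm g (ENNReal.ofReal p) volume := by
  have : ENNReal.HolderTriple (ENNReal.ofReal p) (ENNReal.ofReal p) (ENNReal.ofReal (p / 2)) := by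
    constructor
    rw [← ENNReal.ofReal_inv_of_pos hp, ← ENNReal.ofReal_inv_of_pos (by positivity),
      ← ENNReal.ofReal_add (by positivity) (by positivity)]
    congr 1
    field_simp
    norm_num
  exact eLpNorm_smul_le_mul_eLpNorm (μ := (volume : Measure V)) (f := g) (φ := f)
    g.continuous.aestronglyMeasurable f.continuous.aestronglyMeasurable

namespace MHD.LPF

variable (χ : LPF V)

/-- Bernstein's inequality from `L^p` to `L^∞`. -/
theorem exists_enorm_blockS_le {p : ℝ} (hp : 1 ≤ p) :
    ∃ C : ℝ≥0∞, C ≠ ∞ ∧ ∀ (j : ℤ) (f : 𝓢(V, ℂ)) (x : V), ‖χ.blockS j f x‖ₑ ≤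
      C * (dyadicWeight (j * (Module.finrank ℝ V / p)) *
        eLpNorm (χ.blockS j f) (ENNReal.ofReal p) volume) := by
  refine ⟨_, eLpNorm_multiplierKernel_ne_top χ.fatSymbol (ENNReal.ofReal p).conjExponent,
    fun j f x => ?_⟩
  have h := enorm_dyadicMultiplier_le j χ.fatSymbol (χ.blockS j f)
    (q := ENNReal.ofReal p) (by simpa using hp) ENNReal.ofReal_ne_top x
  rwa [dyadicMultiplier_fatSymbol_blockS, ENNReal.toReal_ofReal (by linarith)] at h

/-- Littlewood–Paley blocks are uniformly bounded on `L^q`. -/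
theorem exists_eLpNorm_blockS_le {q : ℝ≥0∞} (hq : 1 ≤ q) (hq' : q ≠ ∞) :
    ∃ C : ℝ≥0∞, C ≠ ∞ ∧ ∀ (j : ℤ) (f : 𝓢(V, ℂ)),
      eLpNorm (χ.blockS j f) q volume ≤ C * eLpNorm f q volume :=
  ⟨_, eLpNorm_multiplierKernel_ne_top χ.phiSymbol 1, fun j f =>
    eLpNorm_dyadicMultiplier_le j χ.phiSymbol f hq hq'⟩

/-- Bernstein's inequality from `L^{p/2}` to `L^p`. -/
theorem exists_eLpNorm_blockS_le_half {p : ℝ} (hp : 2 ≤ p) :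
    ∃ C : ℝ≥0∞, C ≠ ∞ ∧ ∀ (k : ℤ) (h : 𝓢(V, ℂ)),
      eLpNorm (χ.blockS k h) (ENNReal.ofReal p) volume ≤
        C * (dyadicWeight (k * (Module.finrank ℝ V / p)) *
          eLpNorm h (ENNReal.ofReal (p / 2)) volume) := by
  have hq : 1 ≤ ENNReal.ofReal (p / 2) := by
    rw [ENNReal.one_le_ofReal]; linarith
  obtain ⟨C₁, hC₁, h₁⟩ := χ.exists_eLpNorm_blockS_le hq ENNReal.ofReal_ne_top
  set C₂ := eLpNorm (multiplierKernel χ.phiSymbol)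
    (ENNReal.ofReal (p / 2)).conjExponent volume with hC₂
  refine ⟨C₁ + C₂, ENNReal.add_ne_top.2 ⟨hC₁, eLpNorm_multiplierKernel_ne_top _ _⟩,
    fun k h => ?_⟩
  have h₂ : ∀ x, ‖χ.blockS k h x‖ₑ ≤ C₂ * (dyadicWeight (k * (Module.finrank ℝ V / (p / 2))) *
      eLpNorm h (ENNReal.ofReal (p / 2)) volume) := fun x => by
    have h := enorm_dyadicMultiplier_le k χ.phiSymbol h hq ENNReal.ofReal_ne_top x
    rwa [ENNReal.toReal_ofReal (by linarith)] at h
  have h₃ := eLpNorm_sq_le_of_bound (p := p) (μ := (volume : Measure V)) (by linarith)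
    (χ.blockS k h).continuous.aestronglyMeasurable h₂
  have h₄ : dyadicWeight (k * (Module.finrank ℝ V / (p / 2))) =
      dyadicWeight (k * (Module.finrank ℝ V / p)) *
        dyadicWeight (k * (Module.finrank ℝ V / p)) := by
    rw [← dyadicWeight_add]
    congr 1
    field_simp
    ring
  rw [← ENNReal.pow_le_pow_left_iff two_ne_zero]
  refine h₃.trans ?_
  rw [h₄]
  calc _ ≤ C₂ * (dyadicWeight (k * (Module.finrank ℝ V / p)) *
        dyadicWeight (k * (Module.finrank ℝ V / p)) *
          eLpNorm h (ENNReal.ofReal (p / 2)) volume) *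
          (C₁ * eLpNorm h (ENNReal.ofReal (p / 2)) volume) := by gcongr; exact h₁ k h
    _ = (C₂ * C₁) * (dyadicWeight (k * (Module.finrank ℝ V / p)) *
          eLpNorm h (ENNReal.ofReal (p / 2)) volume) ^ 2 := by ring
    _ ≤ ((C₁ + C₂) * (C₁ + C₂)) * (dyadicWeight (k * (Module.finrank ℝ V / p)) *
          eLpNorm h (ENNReal.ofReal (p / 2)) volume) ^ 2 := by
        gcongr
        · exact le_add_self
        · exact le_self_add
    _ = _ := by ring

theorem blockS_schwartzMul_eq_zero {k j l : ℤ} (f g : 𝓢(V, ℂ))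
    (h : ∀ ξ η : V, (2 : ℝ) ^ k < ‖ξ‖ → ‖ξ‖ < 4 * 2 ^ k → 2 ^ j < ‖η‖ → ‖η‖ < 4 * 2 ^ j →
      2 ^ l < ‖ξ - η‖ → ‖ξ - η‖ < 4 * 2 ^ l → False) :
    χ.blockS k (schwartzMul (χ.blockS j f) (χ.blockS l g)) = 0 := by
  refine schwartz_ext_fourier fun ξ => ?_
  rw [FourierTransform.fourier_zero, zero_apply]
  rcases le_or_gt ‖ξ‖ (2 ^ k) with h1 | h1
  · exact χ.fourier_blockS_eq_zero_of_le _ h1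
  rcases le_or_gt (4 * 2 ^ k) ‖ξ‖ with h2 | h2
  · exact χ.fourier_blockS_eq_zero_of_ge _ h2
  rw [fourier_blockS, fourier_schwartzMul]
  refine mul_eq_zero_of_right _ (integral_eq_zero_of_ae (Eventually.of_forall fun η => ?_))
  simp only [Pi.zero_apply]
  rcases le_or_gt ‖η‖ (2 ^ j) with h3 | h3
  · rw [χ.fourier_blockS_eq_zero_of_le _ h3, zero_mul]
  rcases le_or_gt (4 * 2 ^ j) ‖η‖ with h4 | h4
  · rw [χ.fourier_blockS_eq_zero_of_ge _ h4, zero_mul]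
  rcases le_or_gt ‖ξ - η‖ (2 ^ l) with h5 | h5
  · rw [χ.fourier_blockS_eq_zero_of_le _ h5, mul_zero]
  rcases le_or_gt (4 * 2 ^ l) ‖ξ - η‖ with h6 | h6
  · rw [χ.fourier_blockS_eq_zero_of_ge _ h6, mul_zero]
  exact (h ξ η h1 h2 h3 h4 h5 h6).elim

theorem blockS_schwartzMul_eq_zero_of_low_high {k j l : ℤ} (f g : 𝓢(V, ℂ)) (hjl : j + 3 ≤ l)
    (hk : k < l - 2 ∨ l + 2 < k) :
    χ.blockS k (schwartzMul (χ.blockS j f) (χ.blockS l g)) = 0 := by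
  refine χ.blockS_schwartzMul_eq_zero f g fun ξ η h1 h2 h3 h4 h5 h6 => ?_
  have hj : (2 : ℝ) ^ (j + 3) ≤ 2 ^ l := zpow_le_zpow_right₀ (by norm_num) hjl
  rw [zpow_add₀ two_ne_zero] at hj
  have t1 : ‖ξ‖ ≤ ‖ξ - η‖ + ‖η‖ := by simpa using norm_add_le (ξ - η) η
  have t2 : ‖ξ - η‖ ≤ ‖ξ‖ + ‖η‖ := norm_sub_le ξ η
  have hl : (0 : ℝ) < 2 ^ l := by positivity
  norm_num at hj
  rcases hk with hk | hk
  · have : (2 : ℝ) ^ (k + 3) ≤ 2 ^ l := zpow_le_zpow_right₀ (by norm_num) (by omega)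
    rw [zpow_add₀ two_ne_zero] at this
    norm_num at this
    linarith
  · have : (2 : ℝ) ^ (l + 3) ≤ 2 ^ k := zpow_le_zpow_right₀ (by norm_num) (by omega)
    rw [zpow_add₀ two_ne_zero] at this
    norm_num at this
    linarith

theorem blockS_schwartzMul_eq_zero_of_high {k j l : ℤ} (f g : 𝓢(V, ℂ)) (hjl : j ≤ l + 2)
    (hk : l + 4 < k) :
    χ.blockS k (schwartzMul (χ.blockS j f) (χ.blockS l g)) = 0 := by
  refine χ.blockS_schwartzMul_eq_zero f g fun ξ η h1 h2 h3 h4 h5 h6 => ?_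
  have hj : (2 : ℝ) ^ j ≤ 2 ^ (l + 2) := zpow_le_zpow_right₀ (by norm_num) hjl
  have hk : (2 : ℝ) ^ (l + 5) ≤ 2 ^ k := zpow_le_zpow_right₀ (by norm_num) (by omega)
  rw [zpow_add₀ two_ne_zero] at hj hk
  have t1 : ‖ξ‖ ≤ ‖ξ - η‖ + ‖η‖ := by simpa using norm_add_le (ξ - η) η
  have hl : (0 : ℝ) < 2 ^ l := by positivity
  norm_num at hj hk
  linarith

end MHD.LPF

end Bernstein

/-! ### The paraproduct estimate for a pair of blocks -/

section Pieces

/-- The summable profile `2^{an}` cut off to `n ≤ 4`. -/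
def lowProfile (a : ℝ) (n : ℤ) : ℝ≥0∞ := if n ≤ 4 then dyadicWeight (a * n) else 0

theorem one_le_mul_lowProfile {a : ℝ} (ha : 0 < a) {n : ℤ} (h1 : -2 ≤ n) (h2 : n ≤ 2) :
    1 ≤ dyadicWeight (2 * a) * lowProfile a n := by
  rw [lowProfile, if_pos (by omega), ← dyadicWeight_add, ← dyadicWeight_zero]
  apply dyadicWeight_mono
  have : (-2 : ℝ) ≤ n := by exact_mod_cast h1
  nlinarith

theorem tsum_lowProfile_ne_top {a : ℝ} (ha : 0 < a) : ∑' n, lowProfile a n ≠ ∞ := by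
  have hinj : Function.Injective fun m : ℕ => (4 : ℤ) - m := fun m n h => by
    simp only at h; omega
  rw [← hinj.tsum_eq]
  · have : ∀ m : ℕ, lowProfile a (4 - m) = dyadicWeight (4 * a) * dyadicWeight (-a) ^ m := by
      intro m
      rw [lowProfile, if_pos (by omega)]
      induction m with
      | zero => simp [mul_comm]
      | succ m ih =>
        rw [pow_succ, ← mul_assoc, ← ih, ← dyadicWeight_add]
        congr 1
        push_cast
        ring
    simp_rw [this]
    rw [ENNReal.tsum_mul_left, ENNReal.tsum_geometric]
    refine ENNReal.mul_ne_top (dyadicWeight_ne_top _) (ENNReal.inv_ne_top.2 ?_)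
    have h1 : dyadicWeight (-a) < 1 := by
      rw [dyadicWeight, ENNReal.ofReal_lt_one]
      exact Real.rpow_lt_one_of_one_lt_of_neg one_lt_two (by linarith)
    exact (tsub_pos_of_lt h1).ne'
  · intro n hn
    have : n ≤ 4 := by
      by_contra h
      exact hn (if_neg h)
    exact ⟨(4 - n).toNat, by simp only; omega⟩

variable {V : Type*} [NormedAddCommGroup V] [InnerProductSpace ℝ V]
    [FiniteDimensional ℝ V] [MeasurableSpace V] [BorelSpace V]

namespace MHD.LPF

variable (χ : LPF V)

theorem exists_blockS_mul_block_le {p s : ℝ} (hp : 2 ≤ p) (hs : -(Module.finrank ℝ V / p) < s)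
    (hs' : s ≤ Module.finrank ℝ V / p) :
    ∃ C : ℝ≥0∞, C ≠ ∞ ∧ ∀ (j l : ℤ) (f g : 𝓢(V, ℂ)), ∃ c : ℤ, ∀ k : ℤ,
      dyadicWeight (s * k) * eLpNorm (χ.blockS k (schwartzMul (χ.blockS j f) (χ.blockS l g)))
        (ENNReal.ofReal p) volume ≤
      C * lowProfile (s + Module.finrank ℝ V / p) (k - c) *
        ((dyadicWeight (Module.finrank ℝ V / p * j) *
          eLpNorm (χ.blockS j f) (ENNReal.ofReal p) volume) *
        (dyadicWeight (s * l) * eLpNorm (χ.blockS l g) (ENNReal.ofReal p) volume)) := by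
  obtain ⟨K₁, hK₁, h₁⟩ := χ.exists_eLpNorm_blockS_le (q := ENNReal.ofReal p)
    (by rw [ENNReal.one_le_ofReal]; linarith) ENNReal.ofReal_ne_top
  obtain ⟨K₂, hK₂, h₂⟩ := χ.exists_enorm_blockS_le (p := p) (by linarith)
  obtain ⟨K₃, hK₃, h₃⟩ := χ.exists_eLpNorm_blockS_le_half hp
  have hσ0 : 0 ≤ Module.finrank ℝ V / p := by positivity
  generalize hσ : (Module.finrank ℝ V / p : ℝ) = σ at *
  set D := dyadicWeight (2 * |s| + 2 * (s + σ) + 2 * σ) with hD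
  have ha : 0 < s + σ := by linarith
  refine ⟨(K₁ * K₂ + K₃) * D, ENNReal.mul_ne_top (ENNReal.add_ne_top.2
    ⟨ENNReal.mul_ne_top hK₁ hK₂, hK₃⟩) (dyadicWeight_ne_top _), fun j l f g => ?_⟩
  set F := eLpNorm (χ.blockS j f) (ENNReal.ofReal p) volume
  set G := eLpNorm (χ.blockS l g) (ENNReal.ofReal p) volume
  have habs1 := neg_abs_le s
  have habs2 := le_abs_self s
  have hwD : ∀ {n : ℤ} {x y : ℝ}, -2 ≤ n → n ≤ 2 → x ≤ 2 * |s| + y →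
      dyadicWeight x ≤ D * lowProfile (s + σ) n * dyadicWeight y := by
    intro n x y hn1 hn2 hxy
    calc dyadicWeight x ≤ dyadicWeight (2 * |s| + y) * 1 := by
          rw [mul_one]; exact dyadicWeight_mono hxy
      _ ≤ dyadicWeight (2 * |s| + y) * (dyadicWeight (2 * (s + σ)) * lowProfile (s + σ) n) := by
          gcongr; exact one_le_mul_lowProfile ha hn1 hn2
      _ = dyadicWeight (2 * |s| + 2 * (s + σ)) * lowProfile (s + σ) n * dyadicWeight y := by
          rw [dyadicWeight_add, dyadicWeight_add]; ring
      _ ≤ _ := by gcongr; exact dyadicWeight_mono (by linarith)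
  have hbd : ∀ {n m : ℤ}, -2 ≤ n - m → n - m ≤ 2 → s * n ≤ 2 * |s| + s * m := by
    intro n m h1 h2
    have h1' : (-2 : ℝ) ≤ n - m := by exact_mod_cast h1
    have h2' : (n - m : ℝ) ≤ 2 := by exact_mod_cast h2
    have : |s * (n - m)| ≤ |s| * 2 := by
      rw [abs_mul]; gcongr; exact abs_le.2 ⟨h1', h2'⟩
    have := le_abs_self (s * ((n : ℝ) - m))
    linarith
  rcases le_or_gt (j + 3) l with hjl | hjl
  · refine ⟨l, fun k => ?_⟩
    by_cases hk : k < l - 2 ∨ l + 2 < k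
    · rw [χ.blockS_schwartzMul_eq_zero_of_low_high f g hjl hk]
      simp [FunLike.coe_zero]
    push Not at hk
    calc _ ≤ dyadicWeight (s * k) * (K₁ * (K₂ * (dyadicWeight (j * σ) * F) * G)) := by
          gcongr
          exact (h₁ _ _).trans (by gcongr; exact eLpNorm_schwartzMul_le_of_bound _ _ (h₂ j f) _)
      _ ≤ (D * lowProfile (s + σ) (k - l) * dyadicWeight (s * l)) *
          (K₁ * (K₂ * (dyadicWeight (j * σ) * F) * G)) := by
          gcongr
          exact hwD (by omega) (by omega) (hbd (by omega) (by omega))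
      _ = (K₁ * K₂) * D * lowProfile (s + σ) (k - l) *
          (dyadicWeight (σ * j) * F * (dyadicWeight (s * l) * G)) := by
          rw [mul_comm σ]; ring
      _ ≤ _ := by gcongr; exact le_self_add
  rcases le_or_gt (l + 3) j with hlj | hlj
  · refine ⟨j, fun k => ?_⟩
    rw [schwartzMul_comm]
    by_cases hk : k < j - 2 ∨ j + 2 < k
    · rw [χ.blockS_schwartzMul_eq_zero_of_low_high g f hlj hk]
      simp [FunLike.coe_zero]
    push Not at hk
    have hjl' : (l : ℝ) + 3 ≤ j := by exact_mod_cast hlj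
    calc _ ≤ dyadicWeight (s * k) * (K₁ * (K₂ * (dyadicWeight (l * σ) * G) * F)) := by
          gcongr
          exact (h₁ _ _).trans (by gcongr; exact eLpNorm_schwartzMul_le_of_bound _ _ (h₂ l g) _)
      _ = dyadicWeight (s * k + l * σ) * (K₁ * (K₂ * G * F)) := by rw [dyadicWeight_add]; ring
      _ ≤ (D * lowProfile (s + σ) (k - j) * dyadicWeight (σ * j + s * l)) *
          (K₁ * (K₂ * G * F)) := by
          gcongr
          refine hwD (by omega) (by omega) ?_
          have := hbd (n := k) (m := j) (by omega) (by omega)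
          nlinarith
      _ = (K₁ * K₂) * D * lowProfile (s + σ) (k - j) *
          (dyadicWeight (σ * j) * F * (dyadicWeight (s * l) * G)) := by
          rw [dyadicWeight_add]; ring
      _ ≤ _ := by gcongr; exact le_self_add
  · refine ⟨l, fun k => ?_⟩
    rcases lt_or_ge (l + 4) k with hk | hk
    · rw [χ.blockS_schwartzMul_eq_zero_of_high f g (by omega) hk]
      simp [FunLike.coe_zero]
    have hjl' : (l : ℝ) ≤ j + 2 := by exact_mod_cast (by omega : l ≤ j + 2)
    calc _ ≤ dyadicWeight (s * k) * (K₃ * (dyadicWeight (k * σ) * (F * G))) := by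
          gcongr
          exact (h₃ _ _).trans (by gcongr; exact eLpNorm_schwartzMul_half_le _ _ (by linarith))
      _ = dyadicWeight (s * k + k * σ) * (K₃ * (F * G)) := by rw [dyadicWeight_add]; ring
      _ ≤ dyadicWeight ((2 * |s| + 2 * (s + σ) + 2 * σ) + (s + σ) * ((k - l : ℤ) : ℝ) +
          σ * j + s * l) *
          (K₃ * (F * G)) := by
          gcongr
          apply dyadicWeight_mono
          push_cast
          nlinarith [abs_nonneg s]
      _ = K₃ * D * lowProfile (s + σ) (k - l) *
          (dyadicWeight (σ * j) * F * (dyadicWeight (s * l) * G)) := by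
          rw [dyadicWeight_add, dyadicWeight_add, dyadicWeight_add, lowProfile,
            if_pos (by omega)]
          ring
      _ ≤ _ := by gcongr; exact le_add_self

theorem exists_tsum_blockS_mul_block_le {p s : ℝ} (hp : 2 ≤ p)
    (hs : -(Module.finrank ℝ V / p) < s) (hs' : s ≤ Module.finrank ℝ V / p) :
    ∃ C : ℝ≥0∞, C ≠ ∞ ∧ ∀ (j l : ℤ) (f g : 𝓢(V, ℂ)),
      ∑' k : ℤ, dyadicWeight (s * k) *
        eLpNorm (χ.blockS k (schwartzMul (χ.blockS j f) (χ.blockS l g)))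
        (ENNReal.ofReal p) volume ≤
      C * ((dyadicWeight (Module.finrank ℝ V / p * j) *
          eLpNorm (χ.blockS j f) (ENNReal.ofReal p) volume) *
        (dyadicWeight (s * l) * eLpNorm (χ.blockS l g) (ENNReal.ofReal p) volume)) := by
  obtain ⟨C, hC, h⟩ := χ.exists_blockS_mul_block_le hp hs hs'
  refine ⟨C * ∑' n, lowProfile (s + Module.finrank ℝ V / p) n,
    ENNReal.mul_ne_top hC (tsum_lowProfile_ne_top (by linarith)), fun j l f g => ?_⟩
  obtain ⟨c, hc⟩ := h j l f g
  refine (ENNReal.tsum_le_tsum hc).trans (le_of_eq ?_)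
  rw [ENNReal.tsum_mul_right, ENNReal.tsum_mul_left,
    ← (Equiv.subRight c).tsum_eq (lowProfile (s + Module.finrank ℝ V / p))]
  rfl

end MHD.LPF

end Pieces

/-! ### The product law in homogeneous Besov spaces -/

section Product

variable {V : Type*} [NormedAddCommGroup V] [InnerProductSpace ℝ V]
    [FiniteDimensional ℝ V] [MeasurableSpace V] [BorelSpace V]

omit [FiniteDimensional ℝ V] [MeasurableSpace V] [BorelSpace V] in
theorem coe_schwartz_sum {ι : Type*} (s : Finset ι) (f : ι → 𝓢(V, ℂ)) :
    ((∑ i ∈ s, f i : 𝓢(V, ℂ)) : V → ℂ) = ∑ i ∈ s, (f i : V → ℂ) := by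
  ext x
  simp [sum_apply]

omit [FiniteDimensional ℝ V] [MeasurableSpace V] [BorelSpace V] in
theorem schwartzMul_sum_sum {ι : Type*} (s : Finset ι) (f g : ι → 𝓢(V, ℂ)) :
    schwartzMul (∑ i ∈ s, f i) (∑ j ∈ s, g j) = ∑ i ∈ s, ∑ j ∈ s, schwartzMul (f i) (g j) := by
  ext x
  simp [sum_apply, Finset.sum_mul_sum]

namespace MHD.LPF

variable (χ : LPF V)

theorem blockS_sum {ι : Type*} (s : Finset ι) (k : ℤ) (f : ι → 𝓢(V, ℂ)) :
    χ.blockS k (∑ i ∈ s, f i) = ∑ i ∈ s, χ.blockS k (f i) := by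
  simp only [blockS, dyadicMultiplier, map_sum]

/-- Partial sums of the Littlewood–Paley decomposition. -/
def trunc (n : ℕ) (f : 𝓢(V, ℂ)) : 𝓢(V, ℂ) :=
  ∑ i ∈ Finset.range (2 * n), χ.blockS ((i : ℤ) - n) f

theorem fourier_trunc (n : ℕ) (f : 𝓢(V, ℂ)) (ξ : V) :
    (𝓕 (χ.trunc n f) : 𝓢(V, ℂ)) ξ =
      ((χ.chi ((2 : ℝ) ^ (-(n : ℤ)) • ξ) - χ.chi ((2 : ℝ) ^ (n : ℤ) • ξ) : ℝ) : ℂ) *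
        (𝓕 f : 𝓢(V, ℂ)) ξ := by
  rw [trunc, FourierTransform.fourier_sum, sum_apply]
  simp only [fourier_blockS]
  rw [← Finset.sum_mul, ← Complex.ofReal_sum]
  congr 2
  have h : ∀ i : ℕ, χ.phiHat ((2 : ℝ) ^ (-((i : ℤ) - n)) • ξ) =
      χ.chi ((2 : ℝ) ^ ((n : ℤ) - ((i + 1 : ℕ) : ℤ)) • ξ) -
        χ.chi ((2 : ℝ) ^ ((n : ℤ) - i) • ξ) := by
    intro i
    rw [phiHat, smul_smul, neg_sub, Nat.cast_succ, ← sub_sub, zpow_sub₀ two_ne_zero _ 1, zpow_one,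
      div_eq_inv_mul]
  rw [Finset.sum_congr rfl fun i _ => h i,
    Finset.sum_range_sub (fun i : ℕ => χ.chi ((2 : ℝ) ^ ((n : ℤ) - (i : ℤ)) • ξ))]
  congr 4
  push_cast; ring

theorem norm_fourier_trunc_le (n : ℕ) (f : 𝓢(V, ℂ)) (ξ : V) :
    ‖(𝓕 (χ.trunc n f) : 𝓢(V, ℂ)) ξ‖ ≤ ‖(𝓕 f : 𝓢(V, ℂ)) ξ‖ := by
  rw [fourier_trunc, norm_mul, Complex.norm_real]
  refine mul_le_of_le_one_left (norm_nonneg _) ?_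
  rw [Real.norm_eq_abs, abs_le]
  have := χ.nonneg ((2 : ℝ) ^ (-(n : ℤ)) • ξ)
  have := χ.nonneg ((2 : ℝ) ^ (n : ℤ) • ξ)
  have := χ.chi_le_one ((2 : ℝ) ^ (-(n : ℤ)) • ξ)
  have := χ.chi_le_one ((2 : ℝ) ^ (n : ℤ) • ξ)
  constructor <;> linarith

omit χ in
theorem _root_.schwartz_eq_integral_fourier (f : 𝓢(V, ℂ)) (x : V) :
    f x = ∫ ξ, Real.fourierChar (inner ℝ ξ x) • (𝓕 f : 𝓢(V, ℂ)) ξ := by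
  conv_lhs => rw [← FourierTransform.fourierInv_fourier_eq (F := 𝓢(V, ℂ)) f]
  rw [fourierInv_coe, Real.fourierInv_eq]

theorem norm_trunc_le (n : ℕ) (f : 𝓢(V, ℂ)) (x : V) :
    ‖χ.trunc n f x‖ ≤ ∫ ξ, ‖(𝓕 f : 𝓢(V, ℂ)) ξ‖ := by
  rw [schwartz_eq_integral_fourier]
  refine norm_integral_le_of_norm_le (𝓕 f : 𝓢(V, ℂ)).integrable.norm
    (Eventually.of_forall fun ξ => ?_)
  rw [Circle.norm_smul]
  exact χ.norm_fourier_trunc_le n f ξ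

theorem tendsto_trunc [Nontrivial V] (f : 𝓢(V, ℂ)) (x : V) :
    Tendsto (fun n => χ.trunc n f x) atTop (𝓝 (f x)) := by
  simp_rw [schwartz_eq_integral_fourier _ x]
  have hchar : Continuous fun ξ : V => (Real.fourierChar (inner ℝ ξ x) : ℂ) :=
    continuous_subtype_val.comp (Real.continuous_fourierChar.comp (by fun_prop))
  refine tendsto_integral_of_dominated_convergence (fun ξ => ‖(𝓕 f : 𝓢(V, ℂ)) ξ‖)
    (fun n => (hchar.smul (𝓕 (χ.trunc n f) : 𝓢(V, ℂ)).continuous).aestronglyMeasurable)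
    (𝓕 f : 𝓢(V, ℂ)).integrable.norm
    (fun n => Eventually.of_forall fun ξ => ?_) ?_
  · rw [Circle.norm_smul]
    exact χ.norm_fourier_trunc_le n f ξ
  · have h0 : ∀ᵐ ξ : V, ξ ≠ 0 := by simp [ae_iff]
    filter_upwards [h0] with ξ hξ
    refine tendsto_const_nhds.congr' ?_
    have hpos : 0 < ‖ξ‖ := norm_pos_iff.2 hξ
    have t1 : ∀ᶠ n : ℕ in atTop, ‖ξ‖ ≤ 2 ^ n :=
      (tendsto_pow_atTop_atTop_of_one_lt one_lt_two).eventually_ge_atTop _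
    have t2 : ∀ᶠ n : ℕ in atTop, 2 / ‖ξ‖ ≤ 2 ^ n :=
      (tendsto_pow_atTop_atTop_of_one_lt one_lt_two).eventually_ge_atTop _
    filter_upwards [t1, t2] with n h1 h2
    rw [fourier_trunc, χ.eq_one, χ.supp]
    · simp
    · rw [norm_smul, zpow_natCast, norm_pow, Real.norm_ofNat]
      rwa [div_le_iff₀ hpos] at h2
    · rw [norm_smul, zpow_neg, zpow_natCast, norm_inv, norm_pow, Real.norm_ofNat,
        inv_mul_le_iff₀ (by positivity), mul_one]
      exact h1

theorem tendsto_blockS_trunc_mul [Nontrivial V] (k : ℤ) (f g : 𝓢(V, ℂ)) (x : V) :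
    Tendsto (fun n => χ.blockS k (schwartzMul (χ.trunc n f) (χ.trunc n g)) x) atTop
      (𝓝 (χ.blockS k (schwartzMul f g) x)) := by
  simp_rw [blockS, dyadicMultiplier_eq_convolution]
  set a : ℝ := (2 : ℝ) ^ (-k)
  refine tendsto_integral_of_dominated_convergence
    (fun z => ‖multiplierKernel χ.phiSymbol z‖ * ((∫ ξ, ‖(𝓕 f : 𝓢(V, ℂ)) ξ‖) *
      ∫ ξ, ‖(𝓕 g : 𝓢(V, ℂ)) ξ‖))
    (fun n => Continuous.aestronglyMeasurable ?_)
    ((multiplierKernel χ.phiSymbol).integrable.norm.mul_const _)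
    (fun n => Eventually.of_forall fun z => ?_) (Eventually.of_forall fun z => ?_)
  · exact (multiplierKernel χ.phiSymbol).continuous.mul
      ((schwartzMul (χ.trunc n f) (χ.trunc n g)).continuous.comp (by fun_prop))
  · rw [norm_mul, schwartzMul_apply, norm_mul]
    gcongr
    · exact χ.norm_trunc_le n f _
    · exact χ.norm_trunc_le n g _
  · simp only [schwartzMul_apply]
    exact tendsto_const_nhds.mul ((χ.tendsto_trunc f _).mul (χ.tendsto_trunc g _))

omit χ in
theorem _root_.sum_range_sub_le_tsum (n : ℕ) (a : ℤ → ℝ≥0∞) :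
    ∑ i ∈ Finset.range (2 * n), a ((i : ℤ) - n) ≤ ∑' j, a j := by
  have hinj : Function.Injective fun i : ℕ => (i : ℤ) - n := fun i j h => by
    simp only at h; omega
  exact (Finset.sum_map (Finset.range (2 * n)) ⟨_, hinj⟩ a).symm.le.trans (ENNReal.sum_le_tsum _)

theorem eLpNorm_blockS_mul_le [Nontrivial V] (k : ℤ) (f g : 𝓢(V, ℂ)) {q : ℝ≥0∞} (hq : 1 ≤ q) :
    eLpNorm (χ.blockS k (schwartzMul f g)) q volume ≤
      ∑' j : ℤ, ∑' l : ℤ,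
        eLpNorm (χ.blockS k (schwartzMul (χ.blockS j f) (χ.blockS l g))) q volume := by
  refine (Lp.eLpNorm_lim_le_liminf_eLpNorm (fun n =>
    (χ.blockS k (schwartzMul (χ.trunc n f) (χ.trunc n g))).continuous.aestronglyMeasurable) _
    (Eventually.of_forall fun x => χ.tendsto_blockS_trunc_mul k f g x)).trans ?_
  refine (liminf_le_liminf (Eventually.of_forall fun n => ?_)).trans (liminf_const _).le
  rw [trunc, trunc, schwartzMul_sum_sum, blockS_sum, coe_schwartz_sum]
  refine (eLpNorm_sum_le (fun i _ => (SchwartzMap.continuous _).aestronglyMeasurable) hq).trans ?_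
  refine (Finset.sum_le_sum fun i _ => ?_).trans (sum_range_sub_le_tsum n fun j => ∑' l : ℤ,
        eLpNorm (χ.blockS k (schwartzMul (χ.blockS j f) (χ.blockS l g))) q volume)
  rw [blockS_sum, coe_schwartz_sum]
  exact (eLpNorm_sum_le (fun i _ => (SchwartzMap.continuous _).aestronglyMeasurable) hq).trans
    (sum_range_sub_le_tsum n fun l => _)

theorem besov_eq (s p : ℝ) (f : 𝓢(V, ℂ)) :
    besov χ s p f = ∑' k : ℤ, dyadicWeight (s * k) *
      eLpNorm (χ.blockS k f) (ENNReal.ofReal p) volume := by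
  simp only [besov, block_eq, dyadicWeight]

/-- The product law `Ḃ^{d/p}_{p,1} · Ḃ^s_{p,1} ⊆ Ḃ^s_{p,1}` for `-d/p < s ≤ d/p`. -/
theorem exists_besov_mul_le [Nontrivial V] {p s : ℝ} (hp : 2 ≤ p)
    (hs : -(Module.finrank ℝ V / p) < s) (hs' : s ≤ Module.finrank ℝ V / p) :
    ∃ C : ℝ≥0∞, C ≠ ∞ ∧ ∀ f g : 𝓢(V, ℂ), besov χ s p (fun x => f x * g x) ≤
      C * (besov χ (Module.finrank ℝ V / p) p f * besov χ s p g) := by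
  obtain ⟨C, hC, h⟩ := χ.exists_tsum_blockS_mul_block_le hp hs hs'
  refine ⟨C, hC, fun f g => ?_⟩
  have hfg : (fun x => f x * g x) = schwartzMul f g := rfl
  rw [hfg, besov_eq, besov_eq, besov_eq]
  calc _ ≤ ∑' k : ℤ, dyadicWeight (s * k) * ∑' j : ℤ, ∑' l : ℤ,
        eLpNorm (χ.blockS k (schwartzMul (χ.blockS j f) (χ.blockS l g)))
          (ENNReal.ofReal p) volume := by
        gcongr with k
        exact χ.eLpNorm_blockS_mul_le k f g (by rw [ENNReal.one_le_ofReal]; linarith)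
    _ = ∑' j : ℤ, ∑' l : ℤ, ∑' k : ℤ, dyadicWeight (s * k) *
        eLpNorm (χ.blockS k (schwartzMul (χ.blockS j f) (χ.blockS l g)))
          (ENNReal.ofReal p) volume := by
        simp_rw [← ENNReal.tsum_mul_left]
        rw [ENNReal.tsum_comm]
        congr 1
        ext j
        rw [ENNReal.tsum_comm]
    _ ≤ ∑' j : ℤ, ∑' l : ℤ, C * ((dyadicWeight (Module.finrank ℝ V / p * j) *
          eLpNorm (χ.blockS j f) (ENNReal.ofReal p) volume) *
        (dyadicWeight (s * l) * eLpNorm (χ.blockS l g) (ENNReal.ofReal p) volume)) := by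
        gcongr with j l
        exact h j l f g
    _ = _ := by
        simp_rw [ENNReal.tsum_mul_left, ENNReal.tsum_mul_right]

end MHD.LPF

end Product

/-! ### Derivatives and linear operations in Besov norms -/

section Derivatives

variable {V : Type*} [NormedAddCommGroup V] [InnerProductSpace ℝ V]
    [FiniteDimensional ℝ V] [MeasurableSpace V] [BorelSpace V]

theorem enorm_two_zpow (k : ℤ) : ‖(2 : ℂ) ^ k‖ₑ = dyadicWeight k := by
  rw [← ofReal_norm, norm_zpow, Complex.norm_ofNat, dyadicWeight, Real.rpow_intCast]

namespace MHD.LPF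

variable (χ : LPF V)

theorem exists_besov_lineDeriv_le (e : V) {p : ℝ} (hp : 1 ≤ p) (s : ℝ) :
    ∃ C : ℝ≥0∞, C ≠ ∞ ∧ ∀ f : 𝓢(V, ℂ),
      besov χ s p (LineDeriv.lineDerivOp e f : 𝓢(V, ℂ)) ≤ C * besov χ (s + 1) p f := by
  refine ⟨_, eLpNorm_multiplierKernel_ne_top (χ.derivSymbol e) 1, fun f => ?_⟩
  rw [besov_eq, besov_eq, ← ENNReal.tsum_mul_left]
  refine ENNReal.tsum_le_tsum fun k => ?_
  rw [blockS_lineDeriv, FunLike.coe_smul, eLpNorm_const_smul, enorm_two_zpow]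
  calc _ ≤ dyadicWeight (s * k) * (dyadicWeight k *
        (eLpNorm (multiplierKernel (χ.derivSymbol e)) 1 volume *
          eLpNorm (χ.blockS k f) (ENNReal.ofReal p) volume)) := by
        gcongr
        exact eLpNorm_dyadicMultiplier_le _ _ _ (by rwa [ENNReal.one_le_ofReal])
          ENNReal.ofReal_ne_top
    _ = _ := by rw [add_mul, one_mul, dyadicWeight_add]; ring

theorem exists_besov_le_sum_lineDeriv {ι : Type*} [Fintype ι] (b : OrthonormalBasis ι ℝ V)
    {p : ℝ} (hp : 1 ≤ p) (s : ℝ) :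
    ∃ C : ℝ≥0∞, C ≠ ∞ ∧ ∀ f : 𝓢(V, ℂ),
      besov χ (s + 1) p f ≤ C * ∑ i, besov χ s p (LineDeriv.lineDerivOp (b i) f : 𝓢(V, ℂ)) := by
  have hp' : 1 ≤ ENNReal.ofReal p := by rwa [ENNReal.one_le_ofReal]
  set K : ι → ℝ≥0∞ := fun i => eLpNorm (multiplierKernel (χ.antiderivSymbol (b i))) 1 volume
  refine ⟨∑ i, K i, (ENNReal.sum_lt_top.2 fun i _ =>
    (eLpNorm_multiplierKernel_ne_top (χ.antiderivSymbol (b i)) 1).lt_top).ne, fun f => ?_⟩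
  simp only [besov_eq]
  rw [← Summable.tsum_finsetSum (fun i _ => ENNReal.summable), ← ENNReal.tsum_mul_left]
  refine ENNReal.tsum_le_tsum fun k => ?_
  have hk : eLpNorm (χ.blockS k f) (ENNReal.ofReal p) volume ≤ dyadicWeight (-k) *
      ∑ i, (∑ j, K j) * eLpNorm (χ.blockS k (LineDeriv.lineDerivOp (b i) f))
        (ENNReal.ofReal p) volume := by
    rw [blockS_eq_sum_antideriv χ b, FunLike.coe_smul, eLpNorm_const_smul, enorm_two_zpow,
      coe_schwartz_sum, Int.cast_neg]
    gcongr
    refine (eLpNorm_sum_le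
      (fun i _ => (SchwartzMap.continuous _).aestronglyMeasurable) hp').trans ?_
    gcongr with i
    refine (eLpNorm_dyadicMultiplier_le _ _ _ hp' ENNReal.ofReal_ne_top).trans ?_
    gcongr
    exact Finset.single_le_sum (f := K) (fun _ _ => zero_le) (Finset.mem_univ i)
  calc _ ≤ dyadicWeight ((s + 1) * k) * (dyadicWeight (-k) *
      ∑ i, (∑ j, K j) * eLpNorm (χ.blockS k (LineDeriv.lineDerivOp (b i) f))
        (ENNReal.ofReal p) volume) := by gcongr
    _ = (∑ j, K j) * ((dyadicWeight ((s + 1) * k) * dyadicWeight (-k)) *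
      ∑ i, eLpNorm (χ.blockS k (LineDeriv.lineDerivOp (b i) f))
        (ENNReal.ofReal p) volume) := by rw [← Finset.mul_sum]; ring
    _ = _ := by
      rw [← dyadicWeight_add, Finset.mul_sum, show (s + 1) * k + -(k : ℝ) = s * k by ring]

theorem besov_add_le {p : ℝ} (hp : 1 ≤ p) (s : ℝ) (f g : 𝓢(V, ℂ)) :
    besov χ s p (f + g : 𝓢(V, ℂ)) ≤ besov χ s p f + besov χ s p g := by
  rw [besov_eq, besov_eq, besov_eq, ← ENNReal.tsum_add]
  refine ENNReal.tsum_le_tsum fun k => ?_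
  rw [← mul_add]
  gcongr
  have : χ.blockS k (f + g) = χ.blockS k f + χ.blockS k g := by
    simp only [blockS, dyadicMultiplier, map_add]
  rw [this, FunLike.coe_add]
  exact eLpNorm_add_le (SchwartzMap.continuous _).aestronglyMeasurable
    (SchwartzMap.continuous _).aestronglyMeasurable (by rwa [ENNReal.one_le_ofReal])

theorem besov_smul (p s : ℝ) (c : ℂ) (f : 𝓢(V, ℂ)) :
    besov χ s p (c • f : 𝓢(V, ℂ)) = ‖c‖ₑ * besov χ s p f := by
  rw [besov_eq, besov_eq, ← ENNReal.tsum_mul_left]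
  refine tsum_congr fun k => ?_
  have : χ.blockS k (c • f) = c • χ.blockS k f := by
    simp only [blockS, dyadicMultiplier, map_smul]
  rw [this, FunLike.coe_smul, eLpNorm_const_smul]
  ring

end MHD.LPF

end Derivatives

section TestFunctions

variable {n : ℕ}

/-- Smooth compactly supported real functions on Euclidean space. -/
structure IsTest (f : Euc n → ℝ) : Prop where
  contDiff : ContDiff ℝ (⊤ : ℕ∞) f
  hasCompactSupport : HasCompactSupport f

namespace IsTest

variable {f g : Euc n → ℝ}

theorem zero : IsTest (fun _ : Euc n => (0 : ℝ)) := ⟨contDiff_const, HasCompactSupport.zero⟩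

theorem add (hf : IsTest f) (hg : IsTest g) : IsTest fun y => f y + g y :=
  ⟨hf.1.add hg.1, hf.2.add hg.2⟩

theorem const_mul (c : ℝ) (hf : IsTest f) : IsTest fun y => c * f y :=
  ⟨contDiff_const.mul hf.1, hf.2.mul_left⟩

theorem sub (hf : IsTest f) (hg : IsTest g) : IsTest fun y => f y - g y := by
  simpa [sub_eq_add_neg] using hf.add (hg.const_mul (-1))

theorem mul (hf : IsTest f) (hg : IsTest g) : IsTest fun y => f y * g y :=
  ⟨hf.1.mul hg.1, hf.2.mul_right⟩

theorem sum {ι : Type*} (s : Finset ι) {f : ι → Euc n → ℝ} (hf : ∀ i ∈ s, IsTest (f i)) :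
    IsTest fun y => ∑ i ∈ s, f i y := by
  induction s using Finset.cons_induction with
  | empty => simpa using zero
  | cons a s ha ih =>
    simp only [Finset.sum_cons]
    exact (hf a (by simp)).add (ih fun i hi => hf i (by simp [hi]))

theorem differentiable (hf : IsTest f) : Differentiable ℝ f := hf.1.differentiable (by simp)

theorem pdv (hf : IsTest f) (i : Fin n) : IsTest (MHD.pdv i f) :=
  ⟨(hf.1.fderiv_right (m := (⊤ : ℕ∞)) (by simp)).clm_apply contDiff_const,
    (hf.2.fderiv ℝ).comp_left (g := fun L : Euc n →L[ℝ] ℝ => L (EuclideanSpace.single i 1)) rfl⟩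

/-- A test function as a complex Schwartz function. -/
def toSchwartz (hf : IsTest f) : 𝓢(Euc n, ℂ) :=
  HasCompactSupport.toSchwartzMap (f := fun ξ => (f ξ : ℂ))
    (hf.2.comp_left Complex.ofReal_zero) (Complex.ofRealCLM.contDiff.comp hf.1)

theorem toSchwartz_apply (hf : IsTest f) (x : Euc n) : hf.toSchwartz x = f x := rfl

theorem lineDeriv_toSchwartz (hf : IsTest f) (i : Fin n) :
    LineDeriv.lineDerivOp (EuclideanSpace.single i (1 : ℝ)) hf.toSchwartz =
      (hf.pdv i).toSchwartz := by
  ext x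
  rw [SchwartzMap.lineDerivOp_apply_eq_fderiv, toSchwartz_apply, MHD.pdv]
  have h : HasFDerivAt hf.toSchwartz (Complex.ofRealCLM.comp (fderiv ℝ f x)) x :=
    Complex.ofRealCLM.hasFDerivAt.comp x (hf.differentiable x).hasFDerivAt
  rw [h.fderiv]
  rfl

end IsTest

/-- The homogeneous Besov norm of a real function. -/
def realBesov (χ : LPF (Euc n)) (s p : ℝ) (f : Euc n → ℝ) : ℝ≥0∞ :=
  besov χ s p fun y => (f y : ℂ)

variable (χ : LPF (Euc n)) {f g : Euc n → ℝ} {p : ℝ}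

theorem realBesov_eq (s p : ℝ) (hf : IsTest f) :
    realBesov χ s p f = besov χ s p hf.toSchwartz := rfl

theorem realBesov_add_le (hp : 1 ≤ p) (s : ℝ) (hf : IsTest f) (hg : IsTest g) :
    realBesov χ s p (fun y => f y + g y) ≤ realBesov χ s p f + realBesov χ s p g := by
  have h : (hf.add hg).toSchwartz = hf.toSchwartz + hg.toSchwartz := by
    ext x; simp [IsTest.toSchwartz_apply]
  rw [realBesov_eq χ s p (hf.add hg), h]
  exact χ.besov_add_le hp s _ _

theorem realBesov_const_mul (p s c : ℝ) (hf : IsTest f) :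
    realBesov χ s p (fun y => c * f y) = ‖c‖ₑ * realBesov χ s p f := by
  have h : (hf.const_mul c).toSchwartz = (c : ℂ) • hf.toSchwartz := by
    ext x; simp [IsTest.toSchwartz_apply]
  rw [realBesov_eq χ s p (hf.const_mul c), h, χ.besov_smul]
  congr 1
  simp [← ofReal_norm]

theorem exists_realBesov_mul_le (hn : 0 < n) {s : ℝ} (hp : 2 ≤ p) (hs : -(n / p) < s)
    (hs' : s ≤ n / p) :
    ∃ C : ℝ≥0∞, C ≠ ∞ ∧ ∀ f g : Euc n → ℝ, IsTest f → IsTest g →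
      realBesov χ s p (fun y => f y * g y) ≤
        C * (realBesov χ (n / p) p f * realBesov χ s p g) := by
  have : Nonempty (Fin n) := ⟨⟨0, hn⟩⟩
  obtain ⟨C, hC, h⟩ := χ.exists_besov_mul_le (s := s) hp (by simpa using hs) (by simpa using hs')
  refine ⟨C, hC, fun f g hf hg => ?_⟩
  have := h hf.toSchwartz hg.toSchwartz
  simp only [finrank_euclideanSpace, Fintype.card_fin] at this
  simp only [realBesov, Complex.ofReal_mul]
  exact this

theorem exists_realBesov_pdv_le (hp : 1 ≤ p) (s : ℝ) :
    ∃ C : ℝ≥0∞, C ≠ ∞ ∧ ∀ (i : Fin n) (f : Euc n → ℝ), IsTest f →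
      realBesov χ s p (pdv i f) ≤ C * realBesov χ (s + 1) p f := by
  choose C hC h using fun i : Fin n =>
    χ.exists_besov_lineDeriv_le (EuclideanSpace.single i 1) hp s
  refine ⟨∑ i, C i, (ENNReal.sum_lt_top.2 fun i _ => (hC i).lt_top).ne, fun i f hf => ?_⟩
  have := h i hf.toSchwartz
  rw [hf.lineDeriv_toSchwartz] at this
  refine this.trans (mul_le_mul_left ?_ _)
  exact Finset.single_le_sum (f := C) (fun _ _ => zero_le) (Finset.mem_univ i)

theorem exists_realBesov_le_sum_pdv (hp : 1 ≤ p) (s : ℝ) :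
    ∃ C : ℝ≥0∞, C ≠ ∞ ∧ ∀ f : Euc n → ℝ, IsTest f →
      realBesov χ (s + 1) p f ≤ C * ∑ i, realBesov χ s p (pdv i f) := by
  obtain ⟨C, hC, h⟩ := χ.exists_besov_le_sum_lineDeriv (EuclideanSpace.basisFun (Fin n) ℝ) hp s
  refine ⟨C, hC, fun f hf => ?_⟩
  have := h hf.toSchwartz
  simp only [EuclideanSpace.basisFun_apply, hf.lineDeriv_toSchwartz] at this
  exact this

end TestFunctions

/-! ### Space-time test functions and time integrals -/

section SpaceTime

variable {n : ℕ}

/-- Smooth compactly supported real functions on space-time. -/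
structure IsSpaceTimeTest (w : ℝ → Euc n → ℝ) : Prop where
  contDiff : ContDiff ℝ (⊤ : ℕ∞) (Function.uncurry w)
  hasCompactSupport : HasCompactSupport (Function.uncurry w)

namespace IsSpaceTimeTest

variable {w : ℝ → Euc n → ℝ}

theorem isTest (hw : IsSpaceTimeTest w) (t : ℝ) : IsTest (w t) := by
  refine ⟨hw.1.comp (contDiff_const.prodMk contDiff_id), ?_⟩
  refine HasCompactSupport.intro (hw.2.isCompact.image continuous_snd) fun y hy => ?_
  exact image_eq_zero_of_notMem_tsupport (f := Function.uncurry w) (x := (t, y))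
    fun h => hy ⟨_, h, rfl⟩

theorem sub {v : ℝ → Euc n → ℝ} (hw : IsSpaceTimeTest w) (hv : IsSpaceTimeTest v) :
    IsSpaceTimeTest fun t y => w t y - v t y :=
  ⟨hw.1.sub hv.1, hw.2.sub hv.2⟩

theorem pdv (hw : IsSpaceTimeTest w) (i : Fin n) : IsSpaceTimeTest fun t => MHD.pdv i (w t) := by
  have h : (Function.uncurry fun t => MHD.pdv i (w t)) = fun q : ℝ × Euc n =>
      fderiv ℝ (Function.uncurry w) q (0, EuclideanSpace.single i 1) := by
    ext ⟨t, y⟩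
    have h1 : HasFDerivAt (fun y : Euc n => ((t, y) : ℝ × Euc n))
        (ContinuousLinearMap.inr ℝ ℝ (Euc n)) y := hasFDerivAt_prodMk_right t y
    have h2 : HasFDerivAt (Function.uncurry w) _ (t, y) :=
      (hw.1.differentiable (by simp) (t, y)).hasFDerivAt
    have h3 := h2.comp y h1
    simp only [Function.uncurry_apply_pair, MHD.pdv]
    change fderiv ℝ (Function.uncurry w ∘ fun y => (t, y)) y _ = _
    rw [h3.fderiv]
    simp
  constructor
  · rw [h]
    exact (hw.1.fderiv_right (m := (⊤ : ℕ∞)) (by simp)).clm_apply contDiff_const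
  · rw [h]
    exact (hw.2.fderiv ℝ).comp_left
      (g := fun L : ℝ × Euc n →L[ℝ] ℝ => L (0, EuclideanSpace.single i 1)) rfl

theorem continuous (hw : IsSpaceTimeTest w) : Continuous (Function.uncurry w) := hw.1.continuous

theorem isTest_integral (hw : IsSpaceTimeTest w) {t : ℝ} (ht : 0 ≤ t) :
    IsTest fun y => ∫ τ in (0 : ℝ)..t, w τ y := by
  constructor
  · have hs : IsCompact ((fun q : ℝ × Euc n => -q.1) '' tsupport (Function.uncurry w)) :=
      hw.2.isCompact.image (by fun_prop)
    have hf : LocallyIntegrable (Set.indicator (Set.Ioc 0 t) fun _ => (1 : ℝ)) :=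
      ((integrable_indicator_iff measurableSet_Ioc).2
        (integrableOn_const (by simp))).locallyIntegrable
    have h := contDiffOn_convolution_right_with_param_comp (n := (⊤ : ℕ∞)) (μ := volume)
      (ContinuousLinearMap.mul ℝ ℝ) (s := Set.univ) (v := fun _ : Euc n => (0 : ℝ))
      contDiffOn_const (g := fun y τ => w (-τ) y) isOpen_univ hs
      (fun y τ _ hτ => image_eq_zero_of_notMem_tsupport (f := Function.uncurry w) (x := (-τ, y))
        fun h => hτ ⟨_, h, by simp⟩) hf
      (ContDiff.contDiffOn (hw.1.comp (contDiff_snd.neg.prodMk contDiff_fst)))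
    rw [contDiffOn_univ] at h
    convert h using 2 with y
    rw [convolution_def, intervalIntegral.integral_of_le ht,
      ← integral_indicator measurableSet_Ioc]
    refine integral_congr_ae (Eventually.of_forall fun τ => ?_)
    by_cases hτ : τ ∈ Set.Ioc 0 t <;> simp [hτ]
  · refine HasCompactSupport.intro (hw.2.isCompact.image continuous_snd) fun y hy => ?_
    have : ∀ τ, w τ y = 0 := fun τ =>
      image_eq_zero_of_notMem_tsupport (f := Function.uncurry w) (x := (τ, y))
        fun h => hy ⟨_, h, rfl⟩
    simp [this]

end IsSpaceTimeTest

theorem block_eq_convolution (χ : LPF (Euc n)) (k : ℤ) {f : Euc n → ℝ} (hf : IsTest f)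
    (x : Euc n) :
    χ.block k (fun y => (f y : ℂ)) x =
      ∫ z, multiplierKernel χ.phiSymbol z * (f (x - (2 : ℝ) ^ (-k) • z) : ℂ) := by
  have h := congrFun (χ.block_eq k hf.toSchwartz) x
  rw [MHD.LPF.blockS, dyadicMultiplier_eq_convolution] at h
  exact h

variable (χ : LPF (Euc n)) {w : ℝ → Euc n → ℝ} {p : ℝ}

theorem stronglyMeasurable_block (hw : IsSpaceTimeTest w) (k : ℤ) :
    StronglyMeasurable (Function.uncurry fun (x : Euc n) (τ : ℝ) =>
      χ.block k (fun y => (w τ y : ℂ)) x) := by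
  simp_rw [block_eq_convolution χ k (hw.isTest _)]
  have hc : Continuous fun q : (Euc n × ℝ) × Euc n =>
      multiplierKernel χ.phiSymbol q.2 * (w q.1.2 (q.1.1 - (2 : ℝ) ^ (-k) • q.2) : ℂ) := by
    refine ((multiplierKernel χ.phiSymbol).continuous.comp continuous_snd).mul
      (Complex.continuous_ofReal.comp ?_)
    exact hw.continuous.comp (f := fun q : (Euc n × ℝ) × Euc n =>
      (q.1.2, q.1.1 - (2 : ℝ) ^ (-k) • q.2)) (by fun_prop)
  exact hc.stronglyMeasurable.integral_prod_right'

theorem measurable_eLpNorm_block (hp : 0 < p) (hw : IsSpaceTimeTest w) (k : ℤ) :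
    Measurable fun τ => eLpNorm (χ.block k (fun y => (w τ y : ℂ))) (ENNReal.ofReal p) volume := by
  have hp0 : ENNReal.ofReal p ≠ 0 := by simpa using hp
  simp_rw [eLpNorm_eq_lintegral_rpow_enorm_toReal hp0 ENNReal.ofReal_ne_top]
  refine Measurable.pow_const ?_ _
  exact (((stronglyMeasurable_block χ hw k).measurable.enorm).pow_const _).lintegral_prod_left'

theorem measurable_realBesov (hp : 0 < p) (s : ℝ) (hw : IsSpaceTimeTest w) :
    Measurable fun τ => realBesov χ s p (w τ) := by
  unfold realBesov besov
  exact Measurable.tsum fun k => (measurable_eLpNorm_block χ hp hw k).const_mul _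

theorem block_integral (hw : IsSpaceTimeTest w) {t : ℝ} (ht : 0 ≤ t) (k : ℤ) (x : Euc n) :
    χ.block k (fun y => ((∫ τ in (0 : ℝ)..t, w τ y : ℝ) : ℂ)) x =
      ∫ τ in Set.Ioc 0 t, χ.block k (fun y => (w τ y : ℂ)) x := by
  rw [block_eq_convolution χ k (hw.isTest_integral ht)]
  simp_rw [block_eq_convolution χ k (hw.isTest _)]
  rw [integral_integral_swap]
  · congr 1
    ext z
    rw [intervalIntegral.integral_of_le ht, integral_const_mul, integral_complex_ofReal]
  · obtain ⟨B, hB⟩ := hw.2.exists_bound_of_continuous hw.continuous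
    have h1 : Integrable (fun q : ℝ × Euc n => ((1 : ℝ) * ‖multiplierKernel χ.phiSymbol q.2‖) * B)
        ((volume.restrict (Set.Ioc 0 t)).prod volume) :=
      ((integrable_const (1 : ℝ)).mul_prod
        (multiplierKernel χ.phiSymbol).integrable.norm).mul_const _
    refine h1.mono' (Continuous.aestronglyMeasurable ?_) (Eventually.of_forall fun q => ?_)
    · refine ((multiplierKernel χ.phiSymbol).continuous.comp continuous_snd).mul
        (Complex.continuous_ofReal.comp ?_)
      exact hw.continuous.comp (f := fun q : ℝ × Euc n =>
        (q.1, x - (2 : ℝ) ^ (-k) • q.2)) (by fun_prop)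
    · simp only [Function.uncurry]
      rw [norm_mul, Complex.norm_real, one_mul]
      gcongr
      exact hB (q.1, x - (2 : ℝ) ^ (-k) • q.2)

theorem realBesov_integral_le (hp : 1 ≤ p) (s : ℝ) (hw : IsSpaceTimeTest w) {t : ℝ}
    (ht : 0 ≤ t) :
    realBesov χ s p (fun y => ∫ τ in (0 : ℝ)..t, w τ y) ≤
      ∫⁻ τ in Set.Ioi 0, realBesov χ s p (w τ) := by
  have hp0 : 0 < p := by linarith
  refine le_trans ?_ (lintegral_mono_set (fun τ (hτ : τ ∈ Set.Ioc 0 t) => hτ.1))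
  unfold realBesov besov
  rw [lintegral_tsum fun k => ((measurable_eLpNorm_block χ hp0 hw k).const_mul _).aemeasurable]
  refine ENNReal.tsum_le_tsum fun k => ?_
  rw [lintegral_const_mul _ (measurable_eLpNorm_block χ hp0 hw k)]
  gcongr
  rw [show χ.block k (fun y => ((∫ τ in (0 : ℝ)..t, w τ y : ℝ) : ℂ)) = _ from
    funext fun x => block_integral χ hw ht k x]
  exact eLpNorm_integral_le (by rwa [ENNReal.one_le_ofReal]) ENNReal.ofReal_ne_top
    (stronglyMeasurable_block χ hw k)

end SpaceTime

/-! ### Polynomials of test functions -/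

section Polynomials

theorem totalDegree_adjugate_one_add_le {N : ℕ} (i j : Fin N) :
    (Matrix.adjugate (1 + Matrix.of fun a b : Fin N =>
      (MvPolynomial.X (a, b) : MvPolynomial (Fin N × Fin N) ℝ)) i j).totalDegree ≤ N - 1 := by
  rw [Matrix.adjugate_apply, Matrix.det_apply]
  refine MvPolynomial.totalDegree_finsetSum_le fun τ _ => ?_
  refine (MvPolynomial.totalDegree_smul_le _ _).trans
    ((MvPolynomial.totalDegree_finsetProd _ _).trans ?_)
  have h : ∀ k : Fin N, (Matrix.updateRow (1 + Matrix.of fun a b : Fin N =>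
      (MvPolynomial.X (a, b) : MvPolynomial (Fin N × Fin N) ℝ)) j (Pi.single i 1)
        (τ k) k).totalDegree ≤ if k = τ.symm j then 0 else 1 := by
    intro k
    split_ifs with hk
    · have : τ k = j := by rw [hk, Equiv.apply_symm_apply]
      rw [this, Matrix.updateRow_self]
      by_cases hik : k = i
      · subst hik; simp
      · simp [Pi.single_eq_of_ne hik]
    · have : τ k ≠ j := fun h => hk (by rw [← h, Equiv.symm_apply_apply])
      rw [Matrix.updateRow_ne this, Matrix.add_apply, Matrix.of_apply]
      refine (MvPolynomial.totalDegree_add _ _).trans (max_le ?_ ?_)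
      · by_cases h1 : τ k = k <;> simp [Matrix.one_apply, h1]
      · simp
  refine (Finset.sum_le_sum fun k _ => h k).trans ?_
  rw [Finset.sum_ite, Finset.sum_const_zero, zero_add, Finset.sum_const, smul_eq_mul, mul_one,
    Finset.filter_ne', Finset.card_erase_of_mem (Finset.mem_univ _), Finset.card_univ,
    Fintype.card_fin]

theorem MHD.IsCofactorPoly.totalDegree_le {N : ℕ}
    {Q : Fin N → Fin N → MvPolynomial (Fin N × Fin N) ℝ} (hQ : IsCofactorPoly N Q) (i j : Fin N) :
    (Q i j).totalDegree ≤ N - 1 := by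
  set A := Matrix.adjugate (1 + Matrix.of fun a b : Fin N =>
      (MvPolynomial.X (a, b) : MvPolynomial (Fin N × Fin N) ℝ)) i j with hA
  have h : Q i j = A - MvPolynomial.C (if i = j then 1 else 0) := by
    refine MvPolynomial.funext fun x => ?_
    have h1 := (hQ i j).2 (Matrix.of fun a b => x (a, b))
    have h2 : MvPolynomial.eval x A =
        Matrix.adjugate (1 + Matrix.of fun a b => x (a, b)) i j := by
      have h3 := congrFun (congrFun ((MvPolynomial.eval x).map_adjugate (1 + Matrix.of
        fun a b : Fin N => (MvPolynomial.X (a, b) : MvPolynomial (Fin N × Fin N) ℝ))) i) j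
      rw [RingHom.mapMatrix_apply, Matrix.map_apply] at h3
      have h4 : (MvPolynomial.eval x).mapMatrix (Matrix.of fun a b : Fin N =>
          (MvPolynomial.X (a, b) : MvPolynomial (Fin N × Fin N) ℝ)) =
          Matrix.of fun a b => x (a, b) := by
        ext a b
        simp
      rw [hA, h3, map_add, map_one, h4]
    rw [map_sub, h2, h1, MvPolynomial.eval_C]
    simp
  rw [h]
  exact (MvPolynomial.totalDegree_sub_C_le _ _).trans (totalDegree_adjugate_one_add_le i j)

variable {n : ℕ}

/-- An extended seminorm on test functions. -/
structure IsTestSeminorm (ν : (Euc n → ℝ) → ℝ≥0∞) : Prop where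
  add_le : ∀ f g, IsTest f → IsTest g → ν (fun y => f y + g y) ≤ ν f + ν g
  const_mul : ∀ (c : ℝ) (f), IsTest f → ν (fun y => c * f y) = ‖c‖ₑ * ν f

namespace IsTestSeminorm

variable {ν : (Euc n → ℝ) → ℝ≥0∞} (hν : IsTestSeminorm ν)

include hν

theorem zero : ν (fun _ => 0) = 0 := by
  have := hν.const_mul 0 _ IsTest.zero
  simpa using this

theorem sum_le {ι : Type*} (S : Finset ι) {f : ι → Euc n → ℝ} (hf : ∀ i ∈ S, IsTest (f i)) :
    ν (fun y => ∑ i ∈ S, f i y) ≤ ∑ i ∈ S, ν (f i) := by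
  induction S using Finset.cons_induction with
  | empty => simp [hν.zero]
  | cons a S ha ih =>
    simp only [Finset.sum_cons]
    have h : ∀ i ∈ S, IsTest (f i) := fun i hi => hf i (by simp [hi])
    exact (hν.add_le _ _ (hf a (by simp)) (IsTest.sum S h)).trans (add_le_add le_rfl (ih h))

variable (hmul : ∀ f g, IsTest f → IsTest g → ν (fun y => f y * g y) ≤ ν f * ν g)

include hmul

theorem prod_estimates {ι : Type*} {F G : ι → Euc n → ℝ} {e δ : ℝ≥0∞}
    (hF : ∀ v, IsTest (F v)) (hG : ∀ v, IsTest (G v)) (hFe : ∀ v, ν (F v) ≤ e)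
    (hGe : ∀ v, ν (G v) ≤ e) (hδ : ∀ v, ν (fun y => F v y - G v y) ≤ δ) (S : Multiset ι) :
    S ≠ 0 → IsTest (fun y => (S.map fun v => F v y).prod) ∧
      IsTest (fun y => (S.map fun v => G v y).prod) ∧
      ν (fun y => (S.map fun v => F v y).prod) ≤ e ^ S.card ∧
      ν (fun y => (S.map fun v => F v y).prod - (S.map fun v => G v y).prod) ≤
        S.card * e ^ (S.card - 1) * δ := by
  induction S using Multiset.induction with
  | empty => simp
  | cons a S ih =>
    intro _
    by_cases hS : S = 0
    · subst hS
      simpa using ⟨hF a, hG a, hFe a, hδ a⟩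
    obtain ⟨h1, h2, h3, h4⟩ := ih hS
    simp only [Multiset.map_cons, Multiset.prod_cons, Multiset.card_cons, Nat.add_sub_cancel]
    refine ⟨(hF a).mul h1, (hG a).mul h2, ?_, ?_⟩
    · rw [pow_succ']
      exact (hmul _ _ (hF a) h1).trans (mul_le_mul' (hFe a) h3)
    · have hc : S.card - 1 + 1 = S.card := Nat.sub_add_cancel (Multiset.card_pos.2 hS)
      have : (fun y => F a y * (S.map fun v => F v y).prod - G a y * (S.map fun v => G v y).prod) =
          fun y => (F a y - G a y) * (S.map fun v => F v y).prod +
            G a y * ((S.map fun v => F v y).prod - (S.map fun v => G v y).prod) := by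
        funext y; ring
      rw [this]
      refine (hν.add_le _ _ (((hF a).sub (hG a)).mul h1) ((hG a).mul (h1.sub h2))).trans ?_
      calc _ ≤ δ * e ^ S.card + e * (S.card * e ^ (S.card - 1) * δ) :=
            add_le_add ((hmul _ _ ((hF a).sub (hG a)) h1).trans (mul_le_mul' (hδ a) h3))
              ((hmul _ _ (hG a) (h1.sub h2)).trans (mul_le_mul' (hGe a) h4))
        _ = δ * e ^ S.card + S.card * e ^ (S.card - 1 + 1) * δ := by rw [pow_succ]; ring
        _ = _ := by rw [hc]; push_cast; ring

theorem exists_eval_estimates {ι : Type*} (R : MvPolynomial ι ℝ)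
    (hR : MvPolynomial.constantCoeff R = 0) {D : ℕ} (hD : R.totalDegree ≤ D) {c : ℝ≥0∞}
    (hc : c ≠ ∞) :
    ∃ A : ℝ≥0∞, A ≠ ∞ ∧ ∀ (F G : ι → Euc n → ℝ) (e δ : ℝ≥0∞),
      (∀ v, IsTest (F v)) → (∀ v, IsTest (G v)) → (∀ v, ν (F v) ≤ c * e) →
      (∀ v, ν (G v) ≤ c * e) → (∀ v, ν (fun y => F v y - G v y) ≤ c * δ) →
      IsTest (fun y => MvPolynomial.eval (fun v => F v y) R) ∧
      ν (fun y => MvPolynomial.eval (fun v => F v y) R) ≤ A * ∑ r ∈ Finset.Icc 1 D, e ^ r ∧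
      ν (fun y => MvPolynomial.eval (fun v => F v y) R - MvPolynomial.eval (fun v => G v y) R) ≤
        A * (∑ r ∈ Finset.range D, e ^ r) * δ := by
  classical
  have heval : ∀ x : ι → ℝ, MvPolynomial.eval x R =
      ∑ m ∈ R.support, R.coeff m * ((Finsupp.toMultiset m).map x).prod := by
    intro x
    rw [MvPolynomial.eval_eq]
    refine Finset.sum_congr rfl fun m _ => ?_
    rw [Finset.prod_multiset_map_count, Finsupp.toFinset_toMultiset]
    simp only [Finsupp.count_toMultiset]
  have hm0 : ∀ m ∈ R.support, Finsupp.toMultiset m ≠ 0 := by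
    intro m hm h
    have h0 : m = 0 := by simpa using congrArg Multiset.toFinsupp h
    rw [h0, MvPolynomial.mem_support_iff] at hm
    exact hm hR
  have hmD : ∀ m ∈ R.support, (Finsupp.toMultiset m).card ≤ D := by
    intro m hm
    rw [Finsupp.card_toMultiset]
    exact (MvPolynomial.le_totalDegree hm).trans hD
  simp only [heval]
  refine ⟨∑ m ∈ R.support, ‖R.coeff m‖ₑ * ((Finsupp.toMultiset m).card *
    c ^ (Finsupp.toMultiset m).card), (ENNReal.sum_lt_top.2 fun m _ => ?_).ne, ?_⟩
  · exact ENNReal.mul_lt_top (by simp) (ENNReal.mul_lt_top (ENNReal.natCast_lt_top _)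
      (ENNReal.pow_lt_top hc.lt_top))
  intro F G e δ hF hG hFe hGe hδ
  have key := fun m hm => hν.prod_estimates hmul hF hG hFe hGe hδ (Finsupp.toMultiset m) (hm0 m hm)
  refine ⟨IsTest.sum _ fun m hm => (key m hm).1.const_mul _, ?_, ?_⟩
  · refine (hν.sum_le _ fun m hm => (key m hm).1.const_mul _).trans ?_
    rw [Finset.sum_mul]
    refine Finset.sum_le_sum fun m hm => ?_
    rw [hν.const_mul _ _ (key m hm).1, mul_assoc]
    gcongr
    have h1 : 1 ≤ (Finsupp.toMultiset m).card := Multiset.card_pos.2 (hm0 m hm)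
    refine (key m hm).2.2.1.trans ?_
    rw [mul_pow]
    refine mul_le_mul' ?_ (Finset.single_le_sum (f := fun r => e ^ r) (fun _ _ => zero_le)
      (Finset.mem_Icc.2 ⟨h1, hmD m hm⟩))
    exact le_mul_of_one_le_left zero_le (by exact_mod_cast h1)
  · simp only [← Finset.sum_sub_distrib, ← mul_sub]
    refine (hν.sum_le _ fun m hm => ((key m hm).1.sub (key m hm).2.1).const_mul _).trans ?_
    rw [Finset.sum_mul, Finset.sum_mul]
    refine Finset.sum_le_sum fun m hm => ?_
    rw [hν.const_mul _ _ ((key m hm).1.sub (key m hm).2.1), mul_assoc, mul_assoc]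
    gcongr
    have h1 : 1 ≤ (Finsupp.toMultiset m).card := Multiset.card_pos.2 (hm0 m hm)
    refine (key m hm).2.2.2.trans ?_
    have h2 : e ^ ((Finsupp.toMultiset m).card - 1) ≤ ∑ r ∈ Finset.range D, e ^ r :=
      Finset.single_le_sum (f := fun r => e ^ r) (fun _ _ => zero_le)
        (Finset.mem_range.2 (by have := hmD m hm; omega))
    calc _ = (Finsupp.toMultiset m).card * (c ^ ((Finsupp.toMultiset m).card - 1) * c) *
          (e ^ ((Finsupp.toMultiset m).card - 1) * δ) := by rw [mul_pow]; ring
      _ = (Finsupp.toMultiset m).card * c ^ (Finsupp.toMultiset m).card *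
          (e ^ ((Finsupp.toMultiset m).card - 1) * δ) := by
          rw [← pow_succ, Nat.sub_add_cancel h1]
      _ ≤ _ := by gcongr

end IsTestSeminorm

end Polynomials

/-! ### The nonlinearity for a fixed time -/

section Nonlinearity

variable {N : ℕ}

/-- The nonlinear term, with coefficients `P`, applied to a scalar function `w`. -/
def nonlinearity (P : Fin N → Fin N → Euc N → ℝ) (w : Euc N → ℝ) (y : Euc N) : ℝ :=
  (∑ i : Fin N, ∑ j : Fin N, ∑ k : Fin N, P i k y * pdv i (fun z => P j k z * pdv j w z) y) +
    (∑ i : Fin N, ∑ j : Fin N, P i j y * pdv i (pdv j w) y) +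
    ∑ i : Fin N, ∑ j : Fin N, pdv i (fun z => P j i z * pdv j w z) y

theorem IsTest.pdv_sub {f g : Euc N → ℝ} (hf : IsTest f) (hg : IsTest g) (i : Fin N) :
    MHD.pdv i (fun y => f y - g y) = fun y => MHD.pdv i f y - MHD.pdv i g y := by
  funext y
  unfold MHD.pdv
  rw [fderiv_fun_sub (hf.differentiable y) (hg.differentiable y)]
  rfl

variable {n ν : (Euc N → ℝ) → ℝ≥0∞} {f₁ f₂ g₁ g₂ : Euc N → ℝ} {a d b h B : ℝ≥0∞}

theorem IsTestSeminorm.mul_sub_mul_le (hν : IsTestSeminorm ν)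
    (hmul : ∀ f g, IsTest f → IsTest g → ν (fun y => f y * g y) ≤ n f * ν g)
    (hf₁ : IsTest f₁) (hf₂ : IsTest f₂) (hg₁ : IsTest g₁) (hg₂ : IsTest g₂) (ha : n f₂ ≤ a)
    (hd : n (fun y => f₁ y - f₂ y) ≤ d) (hb : ν g₁ ≤ b) (hh : ν (fun y => g₁ y - g₂ y) ≤ h) :
    ν (fun y => f₁ y * g₁ y - f₂ y * g₂ y) ≤ d * b + a * h := by
  have e : (fun y => f₁ y * g₁ y - f₂ y * g₂ y) =
      fun y => (f₁ y - f₂ y) * g₁ y + f₂ y * (g₁ y - g₂ y) := by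
    funext y; ring
  rw [e]
  refine (hν.add_le _ _ ((hf₁.sub hf₂).mul hg₁) (hf₂.mul (hg₁.sub hg₂))).trans (add_le_add ?_ ?_)
  · exact (hmul _ _ (hf₁.sub hf₂) hg₁).trans (mul_le_mul' hd hb)
  · exact (hmul _ _ hf₂ (hg₁.sub hg₂)).trans (mul_le_mul' ha hh)

theorem IsTestSeminorm.nonlinearity_sub_le (hn : IsTestSeminorm n) (hν : IsTestSeminorm ν)
    (hnmul : ∀ f g, IsTest f → IsTest g → n (fun y => f y * g y) ≤ n f * n g)
    (hνmul : ∀ f g, IsTest f → IsTest g → ν (fun y => f y * g y) ≤ n f * ν g)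
    (hpdv : ∀ i f, IsTest f → ν (pdv i f) ≤ B * n f)
    {P₁ P₂ : Fin N → Fin N → Euc N → ℝ} {w₁ w₂ : Euc N → ℝ}
    (hP₁ : ∀ i j, IsTest (P₁ i j)) (hP₂ : ∀ i j, IsTest (P₂ i j)) (hw₁ : IsTest w₁)
    (hw₂ : IsTest w₂) (ha₁ : ∀ i j, n (P₁ i j) ≤ a) (ha₂ : ∀ i j, n (P₂ i j) ≤ a)
    (hd : ∀ i j, n (fun y => P₁ i j y - P₂ i j y) ≤ d) (hb : ∀ j, n (pdv j w₁) ≤ b)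
    (hh : ∀ j, n (pdv j fun y => w₁ y - w₂ y) ≤ h) :
    ν (fun y => nonlinearity P₁ w₁ y - nonlinearity P₂ w₂ y) ≤
      (N * (N * (N * 2)) + N * (N * 2) + N * (N * 2)) * B *
        (d * (a + 1) * b + a * (a + 1) * h) := by
  have hh' : ∀ j, n (fun y => pdv j w₁ y - pdv j w₂ y) ≤ h := by
    intro j
    rw [← hw₁.pdv_sub hw₂]
    exact hh j
  have hW : ∀ j k, n (fun y => P₁ j k y * pdv j w₁ y - P₂ j k y * pdv j w₂ y) ≤ d * b + a * h :=
    fun j k => hn.mul_sub_mul_le hnmul (hP₁ j k) (hP₂ j k) (hw₁.pdv j) (hw₂.pdv j) (ha₂ j k)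
      (hd j k) (hb j) (hh' j)
  have t₁ : ∀ i j k, IsTest (pdv i fun z => P₁ j k z * pdv j w₁ z) := fun i j k =>
    ((hP₁ j k).mul (hw₁.pdv j)).pdv i
  have t₂ : ∀ i j k, IsTest (pdv i fun z => P₂ j k z * pdv j w₂ z) := fun i j k =>
    ((hP₂ j k).mul (hw₂.pdv j)).pdv i
  have h3 : ∀ i j k, ν (fun y => pdv i (fun z => P₁ j k z * pdv j w₁ z) y -
      pdv i (fun z => P₂ j k z * pdv j w₂ z) y) ≤ B * (d * b + a * h) := by
    intro i j k
    rw [← ((hP₁ j k).mul (hw₁.pdv j)).pdv_sub ((hP₂ j k).mul (hw₂.pdv j))]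
    exact (hpdv _ _ (((hP₁ j k).mul (hw₁.pdv j)).sub ((hP₂ j k).mul (hw₂.pdv j)))).trans
      (mul_le_mul' le_rfl (hW j k))
  have h1 : ∀ i j k, ν (fun y => P₁ i k y * pdv i (fun z => P₁ j k z * pdv j w₁ z) y -
      P₂ i k y * pdv i (fun z => P₂ j k z * pdv j w₂ z) y) ≤
        d * (B * (a * b)) + a * (B * (d * b + a * h)) := by
    intro i j k
    refine hν.mul_sub_mul_le hνmul (hP₁ i k) (hP₂ i k) (t₁ i j k) (t₂ i j k) (ha₂ i k) (hd i k) ?_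
      (h3 i j k)
    refine (hpdv _ _ ((hP₁ j k).mul (hw₁.pdv j))).trans (mul_le_mul' le_rfl ?_)
    exact (hnmul _ _ (hP₁ j k) (hw₁.pdv j)).trans (mul_le_mul' (ha₁ j k) (hb j))
  have h2 : ∀ i j, ν (fun y => P₁ i j y * pdv i (pdv j w₁) y - P₂ i j y * pdv i (pdv j w₂) y) ≤
      d * (B * b) + a * (B * h) := by
    intro i j
    refine hν.mul_sub_mul_le hνmul (hP₁ i j) (hP₂ i j) ((hw₁.pdv j).pdv i) ((hw₂.pdv j).pdv i)
      (ha₂ i j) (hd i j) ((hpdv _ _ (hw₁.pdv j)).trans (mul_le_mul' le_rfl (hb j))) ?_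
    rw [← (hw₁.pdv j).pdv_sub (hw₂.pdv j)]
    exact (hpdv _ _ ((hw₁.pdv j).sub (hw₂.pdv j))).trans (mul_le_mul' le_rfl (hh' j))
  set T := d * (a + 1) * b + a * (a + 1) * h with hT
  have e1 : d * (B * (a * b)) + a * (B * (d * b + a * h)) ≤ 2 * (B * T) := by
    have : 2 * (B * T) = d * (B * (a * b)) + a * (B * (d * b + a * h)) +
        (B * (2 * (d * b) + a * a * h + 2 * (a * h))) := by rw [hT]; ring
    rw [this]; exact le_self_add
  have e2 : d * (B * b) + a * (B * h) ≤ 2 * (B * T) := by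
    have : 2 * (B * T) = d * (B * b) + a * (B * h) +
        (B * (2 * (a * d * b) + d * b + a * h + 2 * (a * a * h))) := by rw [hT]; ring
    rw [this]; exact le_self_add
  have e3 : B * (d * b + a * h) ≤ 2 * (B * T) := by
    refine le_trans (le_of_eq ?_) e2; ring
  have split : (fun y => nonlinearity P₁ w₁ y - nonlinearity P₂ w₂ y) = fun y =>
      ((∑ i : Fin N, ∑ j : Fin N, ∑ k : Fin N,
        (P₁ i k y * pdv i (fun z => P₁ j k z * pdv j w₁ z) y -
          P₂ i k y * pdv i (fun z => P₂ j k z * pdv j w₂ z) y)) +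
        ∑ i : Fin N, ∑ j : Fin N,
          (P₁ i j y * pdv i (pdv j w₁) y - P₂ i j y * pdv i (pdv j w₂) y)) +
        ∑ i : Fin N, ∑ j : Fin N, (pdv i (fun z => P₁ j i z * pdv j w₁ z) y -
          pdv i (fun z => P₂ j i z * pdv j w₂ z) y) := by
    funext y
    simp only [_root_.nonlinearity, Finset.sum_sub_distrib]
    ring
  have s1 : ∀ i j k, IsTest (fun y => P₁ i k y * pdv i (fun z => P₁ j k z * pdv j w₁ z) y -
      P₂ i k y * pdv i (fun z => P₂ j k z * pdv j w₂ z) y) := fun i j k =>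
    ((hP₁ i k).mul (t₁ i j k)).sub ((hP₂ i k).mul (t₂ i j k))
  have s2 : ∀ i j, IsTest (fun y => P₁ i j y * pdv i (pdv j w₁) y -
      P₂ i j y * pdv i (pdv j w₂) y) := fun i j =>
    ((hP₁ i j).mul ((hw₁.pdv j).pdv i)).sub ((hP₂ i j).mul ((hw₂.pdv j).pdv i))
  have s3 : ∀ i j k, IsTest (fun y => pdv i (fun z => P₁ j k z * pdv j w₁ z) y -
      pdv i (fun z => P₂ j k z * pdv j w₂ z) y) := fun i j k => (t₁ i j k).sub (t₂ i j k)
  have hsum : ∀ (F : Fin N → Euc N → ℝ) (c : ℝ≥0∞), (∀ i, IsTest (F i)) → (∀ i, ν (F i) ≤ c) →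
      ν (fun y => ∑ i, F i y) ≤ N * c := by
    intro F c hF hc
    refine (hν.sum_le _ fun i _ => hF i).trans ((Finset.sum_le_sum fun i _ => hc i).trans ?_)
    simp
  rw [split]
  refine (hν.add_le _ _ (IsTest.add (IsTest.sum _ fun i _ => IsTest.sum _ fun j _ =>
    IsTest.sum _ fun k _ => s1 i j k) (IsTest.sum _ fun i _ => IsTest.sum _ fun j _ => s2 i j))
    (IsTest.sum _ fun i _ => IsTest.sum _ fun j _ => s3 i j i)).trans ?_
  refine (add_le_add_left (hν.add_le _ _ (IsTest.sum _ fun i _ => IsTest.sum _ fun j _ =>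
    IsTest.sum _ fun k _ => s1 i j k)
    (IsTest.sum _ fun i _ => IsTest.sum _ fun j _ => s2 i j)) _).trans ?_
  calc _ ≤ (N * (N * (N * (2 * (B * T)))) + N * (N * (2 * (B * T)))) +
        N * (N * (2 * (B * T))) := by
        refine add_le_add (add_le_add ?_ ?_) ?_
        · exact hsum _ _ (fun i => IsTest.sum _ fun j _ => IsTest.sum _ fun k _ => s1 i j k)
            fun i => hsum _ _ (fun j => IsTest.sum _ fun k _ => s1 i j k)
              fun j => hsum _ _ (fun k => s1 i j k) fun k => (h1 i j k).trans e1
        · exact hsum _ _ (fun i => IsTest.sum _ fun j _ => s2 i j)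
            fun i => hsum _ _ (fun j => s2 i j) fun j => (h2 i j).trans e2
        · exact hsum _ _ (fun i => IsTest.sum _ fun j _ => s3 i j i)
            fun i => hsum _ _ (fun j => s3 i j i) fun j => (h3 i j i).trans e3
    _ = _ := by ring

end Nonlinearity

/-! ### Sums of powers -/

section Powers

theorem mul_sum_range_pow (e : ℝ≥0∞) (D : ℕ) :
    e * ∑ r ∈ Finset.range D, e ^ r = ∑ r ∈ Finset.Icc 1 D, e ^ r := by
  rw [Finset.mul_sum, Finset.range_eq_Ico, ← Finset.Ico_add_one_right_eq_Icc,
    ← Finset.sum_Ico_add' (fun r => e ^ r) 0 D 1]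
  simp [pow_succ']

theorem sum_pow_mul_sum_pow_le (e : ℝ≥0∞) (D : ℕ) :
    (∑ r ∈ Finset.Icc 1 D, e ^ r) * ∑ r ∈ Finset.Icc 1 D, e ^ r ≤
      D * (D * ∑ r ∈ Finset.Icc 1 (2 * D), e ^ r) := by
  rw [Finset.sum_mul_sum]
  calc _ ≤ ∑ _i ∈ Finset.Icc 1 D, ∑ _j ∈ Finset.Icc 1 D, ∑ r ∈ Finset.Icc 1 (2 * D), e ^ r := by
        refine Finset.sum_le_sum fun i hi => Finset.sum_le_sum fun j hj => ?_
        rw [← pow_add]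
        rw [Finset.mem_Icc] at hi hj
        exact Finset.single_le_sum (f := fun r => e ^ r) (fun _ _ => zero_le)
          (Finset.mem_Icc.2 ⟨by omega, by omega⟩)
    _ = _ := by simp

theorem sum_pow_mul_sum_pow_add_le (e : ℝ≥0∞) (D : ℕ) :
    (∑ r ∈ Finset.Icc 1 D, e ^ r) * (∑ r ∈ Finset.Icc 1 D, e ^ r) + ∑ r ∈ Finset.Icc 1 D, e ^ r ≤
      (D * D + 1) * ∑ r ∈ Finset.Icc 1 (2 * D), e ^ r := by
  rw [add_mul, one_mul, mul_assoc]
  refine add_le_add (sum_pow_mul_sum_pow_le e D) (Finset.sum_le_sum_of_subset ?_)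
  exact Finset.Icc_subset_Icc le_rfl (by omega)

theorem sum_pow_max_le (e₁ e₂ : ℝ≥0∞) (S : Finset ℕ) :
    ∑ r ∈ S, max e₁ e₂ ^ r ≤ max (∑ r ∈ S, e₁ ^ r) (∑ r ∈ S, e₂ ^ r) := by
  rcases le_total e₁ e₂ with h | h
  · rw [max_eq_right h]; exact le_max_right _ _
  · rw [max_eq_left h]; exact le_max_left _ _

end Powers

/-! ### The flow gradient -/

section FlowGradient

variable {N : ℕ} (χ : LPF (Euc N)) {p : ℝ} {u u₁ u₂ : ℝ → Euc N → Euc N}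

theorem isSpaceTimeTest_component (hu : SmoothCpt N u) (m : Fin N) :
    IsSpaceTimeTest fun t y => u t y m := by
  refine ⟨?_, ?_⟩
  · exact ((EuclideanSpace.proj (𝕜 := ℝ) m).contDiff.comp hu.1 :)
  · exact (hu.2.1.comp_left (g := fun v : Euc N => v m) rfl :)

/-- The time integral of the `v.2`-th derivative of the `v.1`-th component. -/
def integralGradient (u : ℝ → Euc N → Euc N) (t : ℝ) (v : Fin N × Fin N) (y : Euc N) : ℝ :=
  ∫ τ in (0 : ℝ)..t, pdv v.2 (fun z => u τ z v.1) y

theorem integralGradient_sub (hu₁ : ∀ m, IsSpaceTimeTest fun t y => u₁ t y m)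
    (hu₂ : ∀ m, IsSpaceTimeTest fun t y => u₂ t y m) (t : ℝ) (v : Fin N × Fin N) :
    (fun y => integralGradient u₁ t v y - integralGradient u₂ t v y) =
      integralGradient (fun t y => u₁ t y - u₂ t y) t v := by
  funext y
  have hc : ∀ {u : ℝ → Euc N → Euc N}, (∀ m, IsSpaceTimeTest fun t y => u t y m) →
      IntervalIntegrable (fun τ => pdv v.2 (fun z => u τ z v.1) y) volume 0 t := by
    intro u hu
    have h : Continuous fun τ : ℝ => ((τ, y) : ℝ × Euc N) := by fun_prop
    exact (((hu v.1).pdv v.2).continuous.comp h).intervalIntegrable _ _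
  unfold integralGradient
  rw [← intervalIntegral.integral_sub (hc hu₁) (hc hu₂)]
  refine intervalIntegral.integral_congr fun τ _ => ?_
  exact (congrFun (((hu₁ v.1).isTest τ).pdv_sub ((hu₂ v.1).isTest τ) v.2) y).symm

theorem exists_lintegral_realBesov_pdv_le (hp : 1 ≤ p) (s : ℝ) :
    ∃ C : ℝ≥0∞, C ≠ ∞ ∧ ∀ u : ℝ → Euc N → Euc N, (∀ m, IsSpaceTimeTest fun t y => u t y m) →
      ∀ m j, ∫⁻ t in Set.Ioi 0, realBesov χ (s + 1) p (pdv j fun z => u t z m) ≤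
        C * EE χ s p u := by
  obtain ⟨C, hC, h⟩ := exists_realBesov_le_sum_pdv χ hp s
  refine ⟨C, hC, fun u hu m j => ?_⟩
  have hm : ∀ i, Measurable fun t => realBesov χ s p (pdv i (pdv j fun z => u t z m)) := fun i =>
    measurable_realBesov χ (by linarith) s (((hu m).pdv j).pdv i)
  calc _ ≤ ∫⁻ t in Set.Ioi 0, C * ∑ i, realBesov χ s p (pdv i (pdv j fun z => u t z m)) :=
        lintegral_mono fun t => h _ (((hu m).pdv j).isTest t)
    _ = C * ∑ i, ∫⁻ t in Set.Ioi 0, realBesov χ s p (pdv i (pdv j fun z => u t z m)) := by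
        rw [lintegral_const_mul _ (Finset.measurable_sum _ fun i _ => hm i),
          lintegral_finsetSum _ fun i _ => hm i]
    _ ≤ _ := by
        refine mul_le_mul' le_rfl ?_
        refine le_trans ?_ (Finset.single_le_sum (f := fun m => ∑ i : Fin N, ∑ j : Fin N,
          besovT χ s p (Set.Ioi 0) (fun t y => ((pdv i (pdv j fun z => u t z m) y : ℝ) : ℂ)))
          (fun _ _ => zero_le) (Finset.mem_univ m))
        refine Finset.sum_le_sum fun i _ => ?_
        exact Finset.single_le_sum (f := fun j => besovT χ s p (Set.Ioi 0)
          (fun t y => ((pdv i (pdv j fun z => u t z m) y : ℝ) : ℂ))) (fun _ _ => zero_le)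
          (Finset.mem_univ j)

theorem isTestSeminorm_const_mul_realBesov (hp : 1 ≤ p) (s : ℝ) (K : ℝ≥0∞) :
    IsTestSeminorm fun f => K * realBesov χ s p f where
  add_le f g hf hg := by
    rw [← mul_add]
    exact mul_le_mul' le_rfl (realBesov_add_le χ hp s hf hg)
  const_mul c f hf := by
    rw [realBesov_const_mul χ p s c hf]
    ring

end FlowGradient

section Main

variable {N : ℕ} (χ : LPF (Euc N)) {p : ℝ}

theorem exists_besov_estimates (hN : 0 < N) (hp : 2 ≤ p) (hpN : p < 2 * N) :
    ∃ K B : ℝ≥0∞, K ≠ ∞ ∧ B ≠ ∞ ∧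
      (∀ f g, IsTest f → IsTest g → K * realBesov χ (N / p) p (fun y => f y * g y) ≤
        K * realBesov χ (N / p) p f * (K * realBesov χ (N / p) p g)) ∧
      (∀ f g, IsTest f → IsTest g → realBesov χ (-1 + N / p) p (fun y => f y * g y) ≤
        K * realBesov χ (N / p) p f * realBesov χ (-1 + N / p) p g) ∧
      ∀ i f, IsTest f → realBesov χ (-1 + N / p) p (pdv i f) ≤
        B * (K * realBesov χ (N / p) p f) := by
  have hσ : 0 < (N : ℝ) / p := div_pos (by exact_mod_cast hN) (by linarith)
  have hσ' : 1 < 2 * ((N : ℝ) / p) := by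
    rw [← mul_div_assoc, lt_div_iff₀ (by linarith)]; linarith
  obtain ⟨C₁, hC₁, h₁⟩ := exists_realBesov_mul_le χ hN hp (s := N / p) (by linarith) le_rfl
  obtain ⟨C₂, hC₂, h₂⟩ :=
    exists_realBesov_mul_le χ hN hp (s := -1 + N / p) (by linarith) (by linarith)
  obtain ⟨B, hB, h₃⟩ := exists_realBesov_pdv_le χ (by linarith : 1 ≤ p) (-1 + N / p)
  rw [neg_add_cancel_comm] at h₃
  have k₁ : C₁ ≤ C₁ + C₂ + 1 := by rw [add_assoc]; exact le_self_add
  have k₂ : C₂ ≤ C₁ + C₂ + 1 := le_add_right le_add_self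
  refine ⟨C₁ + C₂ + 1, B, by finiteness, hB, fun f g hf hg => ?_, fun f g hf hg => ?_,
    fun i f hf => ?_⟩
  · calc _ ≤ (C₁ + C₂ + 1) * ((C₁ + C₂ + 1) *
          (realBesov χ (N / p) p f * realBesov χ (N / p) p g)) :=
          mul_le_mul' le_rfl ((h₁ f g hf hg).trans (mul_le_mul' k₁ le_rfl))
      _ = _ := by ring
  · rw [mul_assoc]
    exact (h₂ f g hf hg).trans (mul_le_mul' k₂ le_rfl)
  · exact (h₃ i f hf).trans (mul_le_mul' le_rfl (le_mul_of_one_le_left zero_le le_add_self))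

theorem exists_flow_estimates (hp : 1 ≤ p) {K : ℝ≥0∞} (hK : K ≠ ∞)
    (hmul : ∀ f g, IsTest f → IsTest g → K * realBesov χ (N / p) p (fun y => f y * g y) ≤
      K * realBesov χ (N / p) p f * (K * realBesov χ (N / p) p g))
    {Q : Fin N → Fin N → MvPolynomial (Fin N × Fin N) ℝ} (hQ : IsCofactorPoly N Q) :
    ∃ A : ℝ≥0∞, A ≠ ∞ ∧ ∀ (u₁ u₂ : ℝ → Euc N → Euc N) (e : ℝ≥0∞),
      (∀ m, IsSpaceTimeTest fun t y => u₁ t y m) → (∀ m, IsSpaceTimeTest fun t y => u₂ t y m) →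
      EE χ (-1 + N / p) p u₁ ≤ e → EE χ (-1 + N / p) p u₂ ≤ e → ∀ t, 0 ≤ t → ∀ i j,
      IsTest (fun y => Pmat Q u₁ t y i j) ∧
      K * realBesov χ (N / p) p (fun y => Pmat Q u₁ t y i j) ≤
        A * ∑ r ∈ Finset.Icc 1 (N - 1), e ^ r ∧
      K * realBesov χ (N / p) p (fun y => Pmat Q u₁ t y i j - Pmat Q u₂ t y i j) ≤
        A * (∑ r ∈ Finset.range (N - 1), e ^ r) *
          EE χ (-1 + N / p) p fun t y => u₁ t y - u₂ t y := by
  obtain ⟨C, hC, h⟩ := exists_lintegral_realBesov_pdv_le χ hp (-1 + N / p)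
  rw [neg_add_cancel_comm] at h
  have hc : K * C ≠ ∞ := ENNReal.mul_ne_top hK hC
  have hM : ∀ u : ℝ → Euc N → Euc N, (∀ m, IsSpaceTimeTest fun t y => u t y m) → ∀ t, 0 ≤ t →
      ∀ v, IsTest (integralGradient u t v) ∧ K * realBesov χ (N / p) p (integralGradient u t v) ≤
        K * C * EE χ (-1 + N / p) p u := by
    intro u hu t ht v
    refine ⟨((hu v.1).pdv v.2).isTest_integral ht, ?_⟩
    rw [mul_assoc]
    exact mul_le_mul' le_rfl
      ((realBesov_integral_le χ hp _ ((hu v.1).pdv v.2) ht).trans (h u hu v.1 v.2))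
  have hn := isTestSeminorm_const_mul_realBesov χ hp (N / p) K
  choose A hA hE using fun i j =>
    hn.exists_eval_estimates hmul (Q i j) (hQ i j).1 (hQ.totalDegree_le i j) hc
  refine ⟨∑ i, ∑ j, A i j, ?_, ?_⟩
  · exact (ENNReal.sum_lt_top.2 fun i _ => ENNReal.sum_lt_top.2 fun j _ => (hA i j).lt_top).ne
  intro u₁ u₂ e hu₁ hu₂ he₁ he₂ t ht i j
  have hAle : A i j ≤ ∑ i, ∑ j, A i j :=
    (Finset.single_le_sum (f := fun j => A i j) (fun _ _ => zero_le) (Finset.mem_univ j)).trans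
      (Finset.single_le_sum (f := fun i => ∑ j, A i j) (fun _ _ => zero_le) (Finset.mem_univ i))
  obtain ⟨h1, h2, h3⟩ := hE i j (integralGradient u₁ t) (integralGradient u₂ t) e
    (EE χ (-1 + N / p) p fun t y => u₁ t y - u₂ t y) (fun v => (hM u₁ hu₁ t ht v).1)
    (fun v => (hM u₂ hu₂ t ht v).1)
    (fun v => (hM u₁ hu₁ t ht v).2.trans (mul_le_mul' le_rfl he₁))
    (fun v => (hM u₂ hu₂ t ht v).2.trans (mul_le_mul' le_rfl he₂))
    (fun v => by
      rw [integralGradient_sub hu₁ hu₂]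
      exact (hM _ (fun m => (hu₁ m).sub (hu₂ m)) t ht v).2)
  exact ⟨h1, h2.trans (by gcongr), h3.trans (by gcongr)⟩

theorem exists_nonlinearity_sub_le (hN : 0 < N) (hp : 2 ≤ p) (hpN : p < 2 * N)
    {Q : Fin N → Fin N → MvPolynomial (Fin N × Fin N) ℝ} (hQ : IsCofactorPoly N Q) :
    ∃ C : ℝ≥0∞, C ≠ ∞ ∧ ∀ (u₁ u₂ : ℝ → Euc N → Euc N) (e : ℝ≥0∞),
      (∀ m, IsSpaceTimeTest fun t y => u₁ t y m) → (∀ m, IsSpaceTimeTest fun t y => u₂ t y m) →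
      EE χ (-1 + N / p) p u₁ ≤ e → EE χ (-1 + N / p) p u₂ ≤ e → ∀ m,
      ∫⁻ t in Set.Ioi 0, realBesov χ (-1 + N / p) p (fun y =>
        nonlinearity (fun i j y => Pmat Q u₁ t y i j) (fun y => u₁ t y m) y -
          nonlinearity (fun i j y => Pmat Q u₂ t y i j) (fun y => u₂ t y m) y) ≤
        C * (∑ r ∈ Finset.Icc 1 (2 * (N - 1)), e ^ r) *
          EE χ (-1 + N / p) p fun t y => u₁ t y - u₂ t y := by
  have hp1 : 1 ≤ p := by linarith
  have hp0 : 0 < p := by linarith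
  obtain ⟨K, B, hK, hB, hnmul, hνmul, hpdv⟩ := exists_besov_estimates χ hN hp hpN
  obtain ⟨A, hA, hflow⟩ := exists_flow_estimates χ hp1 hK hnmul hQ
  obtain ⟨c, hc, hint⟩ := exists_lintegral_realBesov_pdv_le χ hp1 (-1 + N / p)
  rw [neg_add_cancel_comm] at hint
  have hn := isTestSeminorm_const_mul_realBesov χ hp1 (N / p) K
  have hν : IsTestSeminorm (realBesov χ (-1 + N / p) p) := by
    simpa using isTestSeminorm_const_mul_realBesov χ hp1 (-1 + N / p) 1
  set M : ℝ≥0∞ := (N * (N * (N * 2)) + N * (N * 2) + N * (N * 2)) * B with hM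
  refine ⟨M * (N * (K * c)) * (2 * (A * (A + 1))) * (↑(N - 1) * ↑(N - 1) + 1), ?_, ?_⟩
  · rw [hM]; finiteness
  intro u₁ u₂ e hu₁ hu₂ he₁ he₂ m
  have hsub : IsSpaceTimeTest fun t y => u₁ t y m - u₂ t y m := (hu₁ m).sub (hu₂ m)
  set δ := EE χ (-1 + N / p) p fun t y => u₁ t y - u₂ t y with hδ
  set q := ∑ r ∈ Finset.range (N - 1), e ^ r with hq
  set R := ∑ r ∈ Finset.Icc 1 (N - 1), e ^ r with hR
  have heq : e * q = R := mul_sum_range_pow e (N - 1)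
  set b : ℝ → ℝ≥0∞ := fun t => ∑ j, K * realBesov χ (N / p) p (pdv j fun y => u₁ t y m) with hb
  set h : ℝ → ℝ≥0∞ := fun t =>
    ∑ j, K * realBesov χ (N / p) p (pdv j fun y => u₁ t y m - u₂ t y m) with hh
  have mb : ∀ j, Measurable fun t => realBesov χ (N / p) p (pdv j fun y => u₁ t y m) :=
    fun j => measurable_realBesov χ hp0 _ ((hu₁ m).pdv j)
  have mh : ∀ j, Measurable fun t => realBesov χ (N / p) p (pdv j fun y => u₁ t y m - u₂ t y m) :=
    fun j => measurable_realBesov χ hp0 _ (hsub.pdv j)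
  have ib : ∫⁻ t in Set.Ioi 0, b t ≤ N * (K * c) * e := by
    rw [hb, lintegral_finsetSum _ fun j _ => (mb j).const_mul _]
    simp_rw [lintegral_const_mul _ (mb _)]
    calc _ ≤ ∑ _j : Fin N, K * (c * e) := Finset.sum_le_sum fun j _ =>
          mul_le_mul' le_rfl ((hint u₁ hu₁ m j).trans (mul_le_mul' le_rfl he₁))
      _ = _ := by simp; ring
  have ih : ∫⁻ t in Set.Ioi 0, h t ≤ N * (K * c) * δ := by
    rw [hh, lintegral_finsetSum _ fun j _ => (mh j).const_mul _]
    simp_rw [lintegral_const_mul _ (mh _)]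
    calc _ ≤ ∑ _j : Fin N, K * (c * δ) := Finset.sum_le_sum fun j _ =>
          mul_le_mul' le_rfl (hint _ (fun m => (hu₁ m).sub (hu₂ m)) m j)
      _ = _ := by simp; ring
  have hbm : Measurable b := Finset.measurable_sum _ fun j _ => (mb j).const_mul _
  have hhm : Measurable h := Finset.measurable_sum _ fun j _ => (mh j).const_mul _
  calc _ ≤ ∫⁻ t in Set.Ioi 0, M * (A * q * δ * (A * R + 1) * b t +
          A * R * (A * R + 1) * h t) := by
        refine setLIntegral_mono' measurableSet_Ioi fun t ht => ?_
        have ht' : (0 : ℝ) ≤ t := le_of_lt ht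
        have h1 := hflow u₁ u₂ e hu₁ hu₂ he₁ he₂ t ht'
        have h2 := hflow u₂ u₁ e hu₂ hu₁ he₂ he₁ t ht'
        exact hn.nonlinearity_sub_le hν hnmul hνmul hpdv (fun i j => (h1 i j).1)
          (fun i j => (h2 i j).1) ((hu₁ m).isTest t) ((hu₂ m).isTest t)
          (fun i j => (h1 i j).2.1) (fun i j => (h2 i j).2.1) (fun i j => (h1 i j).2.2)
          (fun j => Finset.single_le_sum (f := fun j => K * realBesov χ (N / p) p
            (pdv j fun y => u₁ t y m)) (fun _ _ => zero_le) (Finset.mem_univ j))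
          (fun j => Finset.single_le_sum (f := fun j => K * realBesov χ (N / p) p
            (pdv j fun y => u₁ t y m - u₂ t y m)) (fun _ _ => zero_le) (Finset.mem_univ j))
    _ = M * (A * q * δ * (A * R + 1) * (∫⁻ t in Set.Ioi 0, b t) +
          A * R * (A * R + 1) * ∫⁻ t in Set.Ioi 0, h t) := by
        rw [lintegral_const_mul _ (by fun_prop),
          lintegral_add_left (hbm.const_mul _), lintegral_const_mul _ hbm,
          lintegral_const_mul _ hhm]
    _ ≤ M * (A * q * δ * (A * R + 1) * (N * (K * c) * e) +
          A * R * (A * R + 1) * (N * (K * c) * δ)) := by gcongr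
    _ = M * (N * (K * c)) * 2 * (A * (A * (R * R) + R)) * δ := by rw [← heq]; ring
    _ ≤ M * (N * (K * c)) * 2 * (A * ((A + 1) * (R * R + R))) * δ := by
        gcongr
        have : (A + 1) * (R * R + R) = A * (R * R) + R + (A * R + R * R) := by ring
        rw [this]
        exact le_self_add
    _ ≤ M * (N * (K * c)) * 2 * (A * ((A + 1) * ((↑(N - 1) * ↑(N - 1) + 1) *
          ∑ r ∈ Finset.Icc 1 (2 * (N - 1)), e ^ r))) * δ := by
        gcongr
        exact sum_pow_mul_sum_pow_add_le e (N - 1)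
    _ = _ := by ring

end Main

end

/-- **contraction estimate (3.15)/(4.15) for `V₁`.** For `N ≤ p < 2N − 1`,
`‖V₁(u₁) − V₁(u₂)‖_{L¹(ℝ₊;Ḃ^{−1+N/p}_{p,1})}
  ≤ C (max_{k=1,2} ∑_{r=1}^{2N−2} E(u_k)^r) ‖D²(u₁ − u₂)‖_{L¹(ℝ₊;Ḃ^{−1+N/p}_{p,1})}`. -/
theorem V1_contraction_estimate
    (N : ℕ) (hN : 2 ≤ N) (p : ℝ) (hp1 : (N : ℝ) ≤ p) (hp2 : p < 2 * N - 1)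
    (χ : LPF (Euc N))
    (Q : Fin N → Fin N → MvPolynomial (Fin N × Fin N) ℝ) (hQ : IsCofactorPoly N Q) :
    ∃ C : ℝ, 0 < C ∧
      ∀ u₁ u₂ : ℝ → Euc N → Euc N, SmoothCpt N u₁ → SmoothCpt N u₂ →
        (∑ m : Fin N, besovT χ (-1 + N / p) p (Set.Ioi 0) (fun t y =>
          (((((∑ i : Fin N, ∑ j : Fin N, ∑ k : Fin N,
                  Pmat Q u₁ t y i k *
                    pdv i (fun z => Pmat Q u₁ t z j k * pdv j (fun z' => u₁ t z' m) z) y) +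
                (∑ i : Fin N, ∑ j : Fin N,
                  Pmat Q u₁ t y i j * pdv i (pdv j fun z => u₁ t z m) y) +
                ∑ i : Fin N, ∑ j : Fin N,
                  pdv i (fun z => Pmat Q u₁ t z j i * pdv j (fun z' => u₁ t z' m) z) y) -
              ((∑ i : Fin N, ∑ j : Fin N, ∑ k : Fin N,
                  Pmat Q u₂ t y i k *
                    pdv i (fun z => Pmat Q u₂ t z j k * pdv j (fun z' => u₂ t z' m) z) y) +
                (∑ i : Fin N, ∑ j : Fin N,
                  Pmat Q u₂ t y i j * pdv i (pdv j fun z => u₂ t z m) y) +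
                ∑ i : Fin N, ∑ j : Fin N,
                  pdv i (fun z => Pmat Q u₂ t z j i * pdv j (fun z' => u₂ t z' m) z) y) : ℝ)) : ℂ))) ≤
        ENNReal.ofReal C *
          (max (∑ r ∈ Finset.Icc 1 (2 * N - 2), EE χ (-1 + N / p) p u₁ ^ r)
               (∑ r ∈ Finset.Icc 1 (2 * N - 2), EE χ (-1 + N / p) p u₂ ^ r)) *
          EE χ (-1 + N / p) p (fun t y => u₁ t y - u₂ t y) := by
  have hN' : (2 : ℝ) ≤ N := by exact_mod_cast hN
  obtain ⟨C, hC, h⟩ := exists_nonlinearity_sub_le χ (by omega) (hN'.trans hp1) (by linarith) hQ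
  have hNC : (N : ℝ≥0∞) * C ≠ ∞ := ENNReal.mul_ne_top (ENNReal.natCast_ne_top _) hC
  refine ⟨((N : ℝ≥0∞) * C).toReal + 1, by positivity, fun u₁ u₂ hu₁ hu₂ => ?_⟩
  have hC' : (N : ℝ≥0∞) * C ≤ ENNReal.ofReal (((N : ℝ≥0∞) * C).toReal + 1) :=
    ENNReal.le_ofReal_iff_toReal_le hNC (by positivity) |>.2 (by linarith)
  refine le_trans (Finset.sum_le_sum fun m _ => h u₁ u₂ _ (isSpaceTimeTest_component hu₁)
    (isSpaceTimeTest_component hu₂) (le_max_left _ _) (le_max_right _ _) m) ?_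
  rw [Finset.sum_const, Finset.card_univ, Fintype.card_fin, nsmul_eq_mul, ← mul_assoc,
    ← mul_assoc, Nat.mul_sub]
  exact mul_le_mul' (mul_le_mul' hC' (sum_pow_max_le _ _ _)) le_rfl
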